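/- arXiv:math/0311094 — 4 statements merged into one kernel-verified Lean document; each statement's English description precedes it below -/
import Mathlib

section
/- Let m ≥ 1, N a nonnegative integer, and u₀ ∈ L¹(ℝ, (1+|x|^{N+1})dx). Define the moments M_j(u₀) = ((−1)^j/j!) ∫_ℝ x^j u₀(x) dx. Then for every p ∈ [1, ∞] there is C > 0 such that ‖G_m(t) ∗ u₀ − ∑_{j=0}^N M_j(u₀) ∂_x^j G_m(·,t)‖_{L^p} ≤ C t^{−(1/m)(1−1/p) − (N+1)/m} ‖ |x|^{N+1} u₀ ‖_{L^1} for all t > 0. -/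
open MeasureTheory Real Complex ENNReal Finset

/-- The generalized heat kernel `G_m(x,t) = (1/(2π)) ∫ e^{−t|ξ|^m + i x ξ} dξ`. -/
noncomputable def heatKernelGen (m t x : ℝ) : ℂ :=
  (1 / (2 * Real.pi) : ℂ) *
    ∫ ξ : ℝ, Complex.exp (((-t * |ξ| ^ m : ℝ) : ℂ) + Complex.I * x * ξ)

/-- Convolution of two functions on ℝ. -/
noncomputable def convOn (f g : ℝ → ℂ) (x : ℝ) : ℂ := ∫ y : ℝ, f (x - y) * g y

/-- The `j`-th moment `M_j(u₀) = ((−1)^j/j!) ∫ x^j u₀(x) dx`. -/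
noncomputable def momentCoeff (u₀ : ℝ → ℂ) (j : ℕ) : ℂ :=
  ((-1 : ℂ) ^ j / (Nat.factorial j : ℂ)) * ∫ x : ℝ, (x : ℂ) ^ j * u₀ x

section HeatAux
open Filter Topology Set

noncomputable def hkE (m a ξ : ℝ) : ℝ := ξ ^ a * Real.exp (-ξ ^ m)

lemma hkE_hasDerivAt (m a ξ : ℝ) (h : 0 < ξ) :
    HasDerivAt (hkE m a) (a * hkE m (a - 1) ξ - m * hkE m (a + m - 1) ξ) ξ := by
  have h1 : HasDerivAt (fun x : ℝ => x ^ a) (a * ξ ^ (a - 1)) ξ :=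
    Real.hasDerivAt_rpow_const (Or.inl h.ne')
  have h2 : HasDerivAt (fun x : ℝ => Real.exp (-x ^ m))
      (Real.exp (-ξ ^ m) * (-(m * ξ ^ (m - 1)))) ξ :=
    ((Real.hasDerivAt_rpow_const (Or.inl h.ne')).neg).exp
  refine (h1.mul h2).congr_deriv ?_
  have : ξ ^ (a + m - 1) = ξ ^ a * ξ ^ (m - 1) := by
    rw [← Real.rpow_add h]; ring_nf
  simp only [hkE, this]
  ring

lemma hkE_integrableOn {m a : ℝ} (hm : 1 ≤ m) (ha : -1 < a) :
    IntegrableOn (hkE m a) (Ioi 0) :=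
  integrableOn_rpow_mul_exp_neg_rpow ha (by linarith)

lemma hkE_continuous {m a : ℝ} (hm : 1 ≤ m) (ha : 0 ≤ a) : Continuous (hkE m a) := by
  unfold hkE
  have h1 : Continuous (fun x : ℝ => x ^ a) := Real.continuous_rpow_const ha
  have h2 : Continuous (fun x : ℝ => x ^ m) := Real.continuous_rpow_const (by linarith)
  fun_prop

lemma hkE_tendsto {m : ℝ} (a : ℝ) (hm : 1 ≤ m) : Tendsto (hkE m a) atTop (𝓝 0) := by
  have h := tendsto_rpow_mul_exp_neg_mul_atTop_nhds_zero a 1 one_pos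
  refine squeeze_zero' ?_ ?_ h
  · filter_upwards [eventually_ge_atTop 0] with x hx
    exact mul_nonneg (Real.rpow_nonneg hx _) (Real.exp_pos _).le
  · filter_upwards [eventually_ge_atTop 1] with x hx
    have : x ≤ x ^ m := by simpa using Real.rpow_le_rpow_of_exponent_le hx hm
    unfold hkE
    gcongr
    linarith

/-- half-line oscillatory integral bound -/
lemma hk_half (m : ℝ) (hm : 1 ≤ m) (k : ℝ) (hk : k = 1 ∨ 2 ≤ k) :
    ∃ B : ℝ, 0 ≤ B ∧ ∀ x : ℝ, x ≠ 0 →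
      ‖∫ ξ in Ioi (0:ℝ), (hkE m k ξ : ℂ) * Complex.exp (Complex.I * x * ξ)‖ ≤ B / x ^ 2 := by
  have hk1 : 1 ≤ k := by rcases hk with h | h <;> linarith
  set f1 : ℝ → ℝ := fun ξ => k * hkE m (k - 1) ξ - m * hkE m (k + m - 1) ξ with hf1
  set f2 : ℝ → ℝ := fun ξ => k * ((k - 1) * hkE m (k - 1 - 1) ξ - m * hkE m (k - 1 + m - 1) ξ)
     - m * ((k + m - 1) * hkE m (k + m - 1 - 1) ξ - m * hkE m (k + m - 1 + m - 1) ξ) with hf2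
  have hd1 : ∀ ξ, 0 < ξ → HasDerivAt f1 (f2 ξ) ξ := fun ξ h =>
    ((hkE_hasDerivAt m _ ξ h).const_mul k).sub ((hkE_hasDerivAt m _ ξ h).const_mul m)
  have hi2 : IntegrableOn f2 (Ioi 0) := by
    have hA : IntegrableOn (fun ξ => (k - 1) * hkE m (k - 1 - 1) ξ) (Ioi 0) := by
      rcases hk with h | h
      · simp [h]
      · exact (hkE_integrableOn hm (by linarith)).const_mul _
    exact ((hA.sub ((hkE_integrableOn hm (by linarith)).const_mul _)).const_mul _).sub
      ((((hkE_integrableOn hm (by linarith)).const_mul _).sub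
        ((hkE_integrableOn hm (by linarith)).const_mul _)).const_mul _)
  have hi0 : IntegrableOn (hkE m k) (Ioi 0) := hkE_integrableOn hm (by linarith)
  have ht1 : Tendsto f1 atTop (𝓝 0) := by
    simpa using ((hkE_tendsto (k - 1) hm).const_mul k).sub ((hkE_tendsto (k + m - 1) hm).const_mul m)
  have hc1 : Continuous f1 :=
    ((hkE_continuous hm (by linarith)).const_mul _).sub
      ((hkE_continuous hm (by linarith)).const_mul _)
  have hc0 : Continuous (hkE m k) := hkE_continuous hm (by linarith)
  refine ⟨|f1 0| + ∫ ξ in Ioi (0:ℝ), |f2 ξ|, by positivity, fun x hx => ?_⟩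
  have hxc : (x : ℂ) ≠ 0 := by exact_mod_cast hx
  set e : ℝ → ℂ := fun ξ => Complex.exp (Complex.I * x * ξ) with he
  have hen : ∀ ξ, ‖e ξ‖ = 1 := fun ξ => by
    have : Complex.I * x * ξ = ((x * ξ : ℝ) : ℂ) * Complex.I := by push_cast; ring
    simp only [he, this, Complex.norm_exp_ofReal_mul_I]
  have hec : Continuous e := by simp only [he]; fun_prop
  have hed : ∀ ξ, HasDerivAt e (Complex.I * x * e ξ) ξ := fun ξ => by
    have h1 : HasDerivAt (fun ξ : ℝ => Complex.I * x * (ξ : ℂ)) (Complex.I * x) ξ := by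
      simpa using (Complex.ofRealCLM.hasDerivAt (x := ξ)).const_mul (Complex.I * (x : ℂ))
    exact (h1.cexp).congr_deriv (by simp only [he]; ring)
  set F : ℝ → ℂ := fun ξ => (-Complex.I * x * (hkE m k ξ : ℂ) + (f1 ξ : ℂ)) * e ξ with hF
  have hFd : ∀ ξ ∈ Ioi (0:ℝ), HasDerivAt F
      ((x:ℂ) ^ 2 * ((hkE m k ξ : ℂ) * e ξ) + (f2 ξ : ℂ) * e ξ) ξ := by
    intro ξ hξ
    have a0 := ((hkE_hasDerivAt m k ξ hξ).ofReal_comp).const_mul (-Complex.I * (x:ℂ))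
    have a1 := (hd1 ξ hξ).ofReal_comp
    refine ((a0.add a1).mul (hed ξ)).congr_deriv ?_
    have e1 : ((k * hkE m (k - 1) ξ - m * hkE m (k + m - 1) ξ : ℝ) : ℂ) = (f1 ξ : ℂ) := rfl
    rw [e1]
    simp only [Pi.add_apply]
    linear_combination (-(x:ℂ)^2 * (hkE m k ξ) * e ξ) * Complex.I_sq
  have hI0 : IntegrableOn (fun ξ => (hkE m k ξ : ℂ) * e ξ) (Ioi 0) :=
    hi0.ofReal.mul_bdd (c := 1) (hec.aestronglyMeasurable) (by simp [hen])
  have hI2 : IntegrableOn (fun ξ => (f2 ξ : ℂ) * e ξ) (Ioi 0) :=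
    hi2.ofReal.mul_bdd (c := 1) (hec.aestronglyMeasurable) (by simp [hen])
  have hFt : Tendsto F atTop (𝓝 0) := by
    have : Tendsto (fun ξ => (-Complex.I * x * (hkE m k ξ : ℂ) + (f1 ξ : ℂ))) atTop (𝓝 0) := by
      have h0 := (Complex.continuous_ofReal.tendsto 0).comp (hkE_tendsto k hm)
      have h1 := (Complex.continuous_ofReal.tendsto 0).comp ht1
      simpa using (h0.const_mul (-Complex.I * (x:ℂ))).add h1
    rw [tendsto_zero_iff_norm_tendsto_zero] at this ⊢
    simpa [hF, hen] using this
  have hFc : Continuous F := by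
    have h0 := Complex.continuous_ofReal.comp hc0
    have h1 := Complex.continuous_ofReal.comp hc1
    exact ((h0.const_mul _).add h1).mul hec
  have key := integral_Ioi_of_hasDerivAt_of_tendsto hFc.continuousWithinAt hFd
    ((hI0.const_mul _).add hI2) hFt
  rw [integral_add (hI0.const_mul _) hI2, integral_const_mul] at key
  have h00 : hkE m k 0 = 0 := by simp [hkE, Real.zero_rpow (by linarith : k ≠ 0)]
  have hF0 : F 0 = f1 0 := by simp [hF, h00, he]
  rw [hF0] at key
  have key2 : (x:ℂ)^2 * ∫ ξ in Ioi (0:ℝ), (hkE m k ξ : ℂ) * e ξ =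
      - (f1 0 : ℂ) - ∫ ξ in Ioi (0:ℝ), (f2 ξ : ℂ) * e ξ := by
    linear_combination key
  have hb : ‖∫ ξ in Ioi (0:ℝ), (f2 ξ : ℂ) * e ξ‖ ≤ ∫ ξ in Ioi (0:ℝ), |f2 ξ| := by
    refine (norm_integral_le_integral_norm _).trans (le_of_eq ?_)
    simp [hen]
  have hx2 : 0 < x ^ 2 := by positivity
  rw [le_div_iff₀ hx2]
  calc _ = ‖(x:ℂ)^2 * ∫ ξ in Ioi (0:ℝ), (hkE m k ξ : ℂ) * e ξ‖ := by
        rw [norm_mul, mul_comm]; simp [he]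
    _ ≤ _ := by
        rw [key2]
        refine (norm_sub_le _ _).trans ?_
        rw [norm_neg, Complex.norm_real, Real.norm_eq_abs]
        gcongr

noncomputable def hkS (m t : ℝ) (j : ℕ) (x ξ : ℝ) : ℂ :=
  (Complex.I * ξ) ^ j * Complex.exp (((-t * |ξ| ^ m : ℝ) : ℂ) + Complex.I * x * ξ)

noncomputable def hkD (m t : ℝ) (j : ℕ) (x : ℝ) : ℂ :=
  (1 / (2 * Real.pi) : ℂ) * ∫ ξ : ℝ, hkS m t j x ξ

lemma hkS_norm (m t : ℝ) (j : ℕ) (x ξ : ℝ) :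
    ‖hkS m t j x ξ‖ = |ξ| ^ j * Real.exp (-t * |ξ| ^ m) := by
  simp [hkS, Complex.norm_exp]

lemma hkS_continuous {m : ℝ} (hm : 1 ≤ m) (t : ℝ) (j : ℕ) (x : ℝ) : Continuous (hkS m t j x) := by
  have h2 : Continuous (fun x : ℝ => |x| ^ m) :=
    (Real.continuous_rpow_const (by linarith)).comp continuous_abs
  unfold hkS
  fun_prop

lemma hk_dom_integrable {m t : ℝ} (hm : 1 ≤ m) (ht : 0 < t) (j : ℕ) :
    Integrable (fun ξ : ℝ => |ξ| ^ j * Real.exp (-t * |ξ| ^ m)) := by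
  have h0 : IntegrableOn (fun x : ℝ => x ^ (j : ℝ) * Real.exp (-t * x ^ m)) (Ioi 0) :=
    integrableOn_rpow_mul_exp_neg_mul_rpow (by have : (0:ℝ) ≤ j := Nat.cast_nonneg j
                                               linarith) (by linarith) ht
  have h1 : IntegrableOn (fun ξ : ℝ => |ξ| ^ j * Real.exp (-t * |ξ| ^ m)) (Ioi 0) := by
    refine h0.congr_fun (fun x hx => ?_) measurableSet_Ioi
    have hx' : (0:ℝ) < x := hx
    simp [abs_of_pos hx']
  have h2 : IntegrableOn (fun ξ : ℝ => |ξ| ^ j * Real.exp (-t * |ξ| ^ m)) (Iic 0) := by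
    rw [← Measure.map_neg_eq_self (volume : Measure ℝ)]
    let m : MeasurableEmbedding fun x : ℝ => -x := (Homeomorph.neg ℝ).measurableEmbedding
    rw [m.integrableOn_map_iff]
    simp_rw [Function.comp_def, abs_neg, neg_preimage, neg_Iic, neg_zero]
    exact Iff.mpr integrableOn_Ici_iff_integrableOn_Ioi h1
  rw [← integrableOn_univ, ← Iic_union_Ioi (a := (0:ℝ))]
  exact h2.union h1

lemma hkS_integrable {m t : ℝ} (hm : 1 ≤ m) (ht : 0 < t) (j : ℕ) (x : ℝ) :
    Integrable (hkS m t j x) :=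
  (hk_dom_integrable hm ht j).mono' (hkS_continuous hm t j x).aestronglyMeasurable
    (ae_of_all _ fun ξ => (hkS_norm m t j x ξ).le)

lemma hkD_zero (m t : ℝ) : heatKernelGen m t = hkD m t 0 := by
  ext x; simp [heatKernelGen, hkD, hkS]

lemma hkD_hasDerivAt {m t : ℝ} (hm : 1 ≤ m) (ht : 0 < t) (j : ℕ) (x : ℝ) :
    HasDerivAt (hkD m t j) (hkD m t (j + 1) x) x := by
  have := hasDerivAt_integral_of_dominated_loc_of_deriv_le (μ := volume)
    (F := fun x ξ => hkS m t j x ξ)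
    (F' := fun x ξ => hkS m t (j + 1) x ξ) (x₀ := x) (s := univ) univ_mem
    (Eventually.of_forall fun x => (hkS_continuous hm t j x).aestronglyMeasurable)
    (hkS_integrable hm ht j x) (hkS_continuous hm t (j+1) x).aestronglyMeasurable
    (bound := fun ξ : ℝ => |ξ| ^ (j+1) * Real.exp (-t * |ξ| ^ m))
    (ae_of_all _ fun ξ x _ => (hkS_norm m t (j+1) x ξ).le) (hk_dom_integrable hm ht (j+1))
    (ae_of_all _ fun ξ x _ => by
      have h1 : HasDerivAt (fun x : ℝ => ((-t * |ξ| ^ m : ℝ) : ℂ) + Complex.I * (x:ℂ) * (ξ : ℂ))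
          (Complex.I * ξ) x := by
        simpa using (((Complex.ofRealCLM.hasDerivAt (x := x)).const_mul Complex.I).mul_const
          (ξ:ℂ)).const_add ((-t * |ξ| ^ m : ℝ) : ℂ)
      exact ((h1.cexp).const_mul ((Complex.I * (ξ:ℂ)) ^ j)).congr_deriv
        (by simp only [hkS]; ring))
  exact this.2.const_mul _

lemma hkD_iteratedDeriv {m t : ℝ} (hm : 1 ≤ m) (ht : 0 < t) (j : ℕ) :
    iteratedDeriv j (heatKernelGen m t) = hkD m t j := by
  induction j with
  | zero => simp [hkD_zero]
  | succ j ih =>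
    rw [iteratedDeriv_succ, ih]
    ext x
    exact (hkD_hasDerivAt hm ht j x).deriv

lemma hkD_continuous {m t : ℝ} (hm : 1 ≤ m) (ht : 0 < t) (j : ℕ) : Continuous (hkD m t j) :=
  continuous_iff_continuousAt.mpr fun x => (hkD_hasDerivAt hm ht j x).continuousAt

lemma hkD_bdd {m t : ℝ} (j : ℕ) :
    ∃ B, ∀ x, ‖hkD m t j x‖ ≤ B := by
  refine ⟨‖(1 / (2 * Real.pi) : ℂ)‖ * ∫ ξ : ℝ, |ξ| ^ j * Real.exp (-t * |ξ| ^ m), fun x => ?_⟩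
  rw [hkD, norm_mul]
  gcongr
  refine (norm_integral_le_integral_norm _).trans (le_of_eq ?_)
  simp only [hkS_norm]

lemma hkD_decay {m : ℝ} (hm : 1 ≤ m) (j : ℕ) (hj : 1 ≤ j) :
    ∃ B, ∀ x, x ≠ 0 → ‖hkD m 1 j x‖ ≤ B / x ^ 2 := by
  obtain ⟨B, hB0, hB⟩ := hk_half m hm (j : ℝ) (by
    rcases hj.eq_or_lt with h | h
    · left; simp [← h]
    · right; exact_mod_cast h)
  refine ⟨‖(1 / (2 * Real.pi) : ℂ)‖ * (B + B), fun x hx => ?_⟩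
  rw [hkD, norm_mul, mul_div_assoc]
  gcongr
  have hi := hkS_integrable hm one_pos j x
  rw [← setIntegral_univ, ← Iic_union_Ioi (a := (0:ℝ)),
    setIntegral_union (Iic_disjoint_Ioi le_rfl) measurableSet_Ioi hi.integrableOn hi.integrableOn]
  have e1 : ∫ ξ in Ioi (0:ℝ), hkS m 1 j x ξ =
      Complex.I ^ j * ∫ ξ in Ioi (0:ℝ), (hkE m j ξ : ℂ) * Complex.exp (Complex.I * x * ξ) := by
    rw [← integral_const_mul]
    refine setIntegral_congr_fun measurableSet_Ioi fun ξ hξ => ?_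
    have hξ' : (0:ℝ) < ξ := hξ
    simp only [hkS, hkE, abs_of_pos hξ', Real.rpow_natCast, Complex.exp_add, mul_pow]
    push_cast
    ring_nf
  have e2 : ∫ ξ in Iic (0:ℝ), hkS m 1 j x ξ = (-Complex.I) ^ j *
      ∫ ξ in Ioi (0:ℝ), (hkE m j ξ : ℂ) * Complex.exp (Complex.I * (-x : ℝ) * ξ) := by
    rw [← integral_const_mul]
    have := integral_comp_neg_Ioi 0 (hkS m 1 j x)
    rw [neg_zero] at this
    rw [← this]
    refine setIntegral_congr_fun measurableSet_Ioi fun ξ hξ => ?_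
    have hξ' : (0:ℝ) < ξ := hξ
    simp only [hkS, hkE, abs_neg, abs_of_pos hξ', Real.rpow_natCast, Complex.exp_add]
    rw [show Complex.I * ((-ξ : ℝ) : ℂ) = (-Complex.I) * ξ by push_cast; ring, mul_pow]
    push_cast
    ring_nf
  rw [e1, e2, add_div]
  refine (norm_add_le _ _).trans (add_le_add ?_ ?_)
  · have := hB (-x) (neg_ne_zero.mpr hx)
    simpa using this
  · simpa using hB x hx

lemma hkD_one_bound {m : ℝ} (hm : 1 ≤ m) (j : ℕ) (hj : 1 ≤ j) :
    ∃ B > 0, ∀ x, ‖hkD m 1 j x‖ ≤ B * (1 + x ^ 2)⁻¹ := by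
  obtain ⟨B1, h1⟩ := hkD_bdd (m := m) (t := 1) j
  obtain ⟨B2, h2⟩ := hkD_decay hm j hj
  have hB1 : 0 ≤ B1 := (norm_nonneg _).trans (h1 0)
  have hB2 : 0 ≤ B2 := by
    have := (norm_nonneg _).trans (h2 1 one_ne_zero); simpa using this
  refine ⟨B1 + B2 + 1, by positivity, fun x => ?_⟩
  rw [← div_eq_mul_inv, le_div_iff₀ (by positivity)]
  have : ‖hkD m 1 j x‖ * x ^ 2 ≤ B2 := by
    rcases eq_or_ne x 0 with rfl | hx
    · simpa using hB2
    · exact (le_div_iff₀ (by positivity)).mp (h2 x hx)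
  nlinarith [h1 x]

lemma hkD_scale {m t : ℝ} (hm : 1 ≤ m) (ht : 0 < t) (j : ℕ) (x : ℝ) :
    hkD m t j x = (((t ^ (1 / m))⁻¹ ^ (j + 1) : ℝ) : ℂ) * hkD m 1 j (x * (t ^ (1 / m))⁻¹) := by
  set l := t ^ (1 / m) with hl
  have hlp : 0 < l := Real.rpow_pos_of_pos ht _
  have hlm : l ^ m = t := by
    rw [hl, ← Real.rpow_mul ht.le]; field_simp; simp
  have hlc : (l : ℂ) ≠ 0 := by exact_mod_cast hlp.ne'
  have := Measure.integral_comp_mul_left (hkS m 1 j (x * l⁻¹)) l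
  have e : ∀ ξ, hkS m t j x ξ = ((l⁻¹ ^ j : ℝ) : ℂ) * hkS m 1 j (x * l⁻¹) (l * ξ) := by
    intro ξ
    simp only [hkS, abs_mul, abs_of_pos hlp, Real.mul_rpow hlp.le (abs_nonneg ξ), hlm]
    push_cast
    rw [← mul_assoc, ← mul_pow]
    congr 2
    · field_simp
    · field_simp
  simp only [hkD, e]
  rw [integral_const_mul, this, abs_of_pos (inv_pos.mpr hlp), Complex.real_smul]
  push_cast
  ring

lemma hkD_bound {m : ℝ} (hm : 1 ≤ m) (j : ℕ) (hj : 1 ≤ j) :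
    ∃ B > 0, ∀ t, 0 < t → ∀ x, ‖hkD m t j x‖ ≤
      (t ^ (1 / m))⁻¹ ^ (j + 1) * (B * (1 + (x * (t ^ (1 / m))⁻¹) ^ 2)⁻¹) := by
  obtain ⟨B, hB, h⟩ := hkD_one_bound hm j hj
  refine ⟨B, hB, fun t ht x => ?_⟩
  have hlp : 0 < t ^ (1 / m) := Real.rpow_pos_of_pos ht _
  rw [hkD_scale hm ht, norm_mul, Complex.norm_real, Real.norm_of_nonneg (by positivity)]
  gcongr
  exact h _

lemma hk_taylor_deriv (D : ℕ → ℝ → ℂ) (hD : ∀ j x, HasDerivAt (D j) (D (j + 1) x) x)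
    (x y : ℝ) (N : ℕ) (s : ℝ) :
    HasDerivAt (fun s : ℝ => ∑ j ∈ Finset.range (N + 1),
        (((1 - s : ℝ) : ℂ) * (-(y:ℂ))) ^ j / (Nat.factorial j : ℂ) * D j (x - s * y))
      ((((1 - s : ℝ) : ℂ) * (-(y:ℂ))) ^ N / (Nat.factorial N : ℂ) * (-(y:ℂ)) *
        D (N + 1) (x - s * y)) s := by
  have hDc : ∀ j, HasDerivAt (fun s : ℝ => D j (x - s * y)) ((-(y:ℂ)) * D (j + 1) (x - s * y)) s := by
    intro j
    have h1 : HasDerivAt (fun s : ℝ => x - s * y) (-y) s := by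
      simpa using ((hasDerivAt_id s).mul_const y).const_sub x
    have := (hD j (x - s * y)).scomp s h1
    simpa [Function.comp_def] using this
  have hl : HasDerivAt (fun s : ℝ => ((1 - s : ℝ) : ℂ) * (-(y:ℂ))) y s := by
    have h1 : HasDerivAt (fun s : ℝ => 1 - s) (-1) s := by
      simpa using (hasDerivAt_id s).const_sub 1
    simpa using (h1.ofReal_comp).mul_const (-(y:ℂ))
  induction N with
  | zero => simpa using hDc 0
  | succ N ih =>
    simp_rw [Finset.sum_range_succ _ (N + 1)]
    have h2 := ((hl.pow (N + 1)).div_const (Nat.factorial (N + 1) : ℂ)).mul (hDc (N + 1))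
    refine (ih.add h2).congr_deriv ?_
    have hf : (Nat.factorial N : ℂ) ≠ 0 := by exact_mod_cast Nat.factorial_ne_zero N
    have hn : ((N : ℂ) + 1) ≠ 0 := by exact_mod_cast Nat.succ_ne_zero N
    rw [Nat.factorial_succ]
    simp only [Pi.pow_apply, Nat.add_sub_cancel]
    push_cast
    field_simp
    ring

lemma hk_taylor_bound (D : ℕ → ℝ → ℂ) (hD : ∀ j x, HasDerivAt (D j) (D (j + 1) x) x)
    (x y : ℝ) (N : ℕ) :
    ‖D 0 (x - y) - ∑ j ∈ Finset.range (N + 1),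
        (-(y:ℂ)) ^ j / (Nat.factorial j : ℂ) * D j x‖ₑ ≤
      ‖y‖ₑ ^ (N + 1) * ∫⁻ s in Ioc (0:ℝ) 1, ‖D (N + 1) (x - s * y)‖ₑ := by
  have hc : Continuous (D (N + 1)) :=
    continuous_iff_continuousAt.mpr fun x => (hD (N + 1) x).continuousAt
  have key := intervalIntegral.integral_eq_sub_of_hasDerivAt (a := 0) (b := 1)
    (fun s _ => hk_taylor_deriv D hD x y N s) (by
      apply Continuous.intervalIntegrable
      fun_prop)
  have e1 : ∑ j ∈ Finset.range (N + 1),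
        (((1 - 1 : ℝ) : ℂ) * (-(y:ℂ))) ^ j / (Nat.factorial j : ℂ) * D j (x - 1 * y) = D 0 (x - y) := by
    rw [Finset.sum_eq_single 0]
    · simp
    · intro j _ hj; simp [hj]
    · simp
  rw [e1] at key
  simp only [sub_zero, Complex.ofReal_one, one_mul, zero_mul] at key
  rw [← key, intervalIntegral.integral_of_le zero_le_one]
  refine (enorm_integral_le_lintegral_enorm _).trans ?_
  rw [← lintegral_const_mul' _ _ (by simp)]
  refine setLIntegral_mono' measurableSet_Ioc fun s hs => ?_
  rw [enorm_mul]
  gcongr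
  rw [← ofReal_norm, ← ofReal_norm, ← ENNReal.ofReal_pow (norm_nonneg _)]
  apply ENNReal.ofReal_le_ofReal
  rw [norm_mul, norm_div, norm_pow, norm_mul, norm_neg, Complex.norm_real, Complex.norm_real,
    Complex.norm_natCast, pow_succ]
  gcongr
  have hf : (1:ℝ) ≤ (Nat.factorial N : ℝ) := by exact_mod_cast Nat.one_le_iff_ne_zero.mpr (Nat.factorial_ne_zero N)
  have h1 : ‖1 - s‖ ≤ 1 := by
    rw [Real.norm_eq_abs, abs_le]; constructor <;> linarith [hs.1, hs.2]
  refine (div_le_self (by positivity) hf).trans ?_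
  gcongr
  exact mul_le_of_le_one_left (norm_nonneg _) h1

/-- integrated remainder bounds -/
lemma hk_remainder_bounds (H W : ℝ → ℝ≥0∞) (R : ℝ → ℂ) (hH : Measurable H)
    (hW : AEMeasurable W)
    (hR : ∀ x, ‖R x‖ₑ ≤ ∫⁻ y, W y * ∫⁻ s in Ioc (0:ℝ) 1, H (x - s * y)) :
    (∀ S : ℝ≥0∞, S ≠ ⊤ → (∀ x, H x ≤ S) → ∀ x, ‖R x‖ₑ ≤ S * ∫⁻ y, W y) ∧
    ∫⁻ x, ‖R x‖ₑ ≤ (∫⁻ x, H x) * ∫⁻ y, W y := by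
  constructor
  · intro S hS hHS x
    refine (hR x).trans ?_
    rw [← lintegral_const_mul' _ _ hS]
    refine lintegral_mono fun y => ?_
    rw [mul_comm S]
    gcongr
    calc ∫⁻ s in Ioc (0:ℝ) 1, H (x - s * y) ≤ ∫⁻ s in Ioc (0:ℝ) 1, S := lintegral_mono fun s => hHS _
      _ = S := by simp
  · have hm3 : Measurable (fun p : (ℝ × ℝ) × ℝ => H (p.1.1 - p.2 * p.1.2)) :=
      hH.comp (by fun_prop)
    have hm2 : Measurable (fun p : ℝ × ℝ => ∫⁻ s in Ioc (0:ℝ) 1, H (p.1 - s * p.2)) :=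
      hm3.lintegral_prod_right'
    calc ∫⁻ x, ‖R x‖ₑ ≤ ∫⁻ x, ∫⁻ y, W y * ∫⁻ s in Ioc (0:ℝ) 1, H (x - s * y) := lintegral_mono hR
      _ = ∫⁻ y, ∫⁻ x, W y * ∫⁻ s in Ioc (0:ℝ) 1, H (x - s * y) := by
        apply lintegral_lintegral_swap
        exact (hW.comp_snd).mul hm2.aemeasurable
      _ = ∫⁻ y, W y * ∫⁻ x, H x := by
        refine lintegral_congr fun y => ?_
        have hm1 : Measurable (fun x : ℝ => ∫⁻ s in Ioc (0:ℝ) 1, H (x - s * y)) :=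
          hm2.comp (measurable_id.prodMk measurable_const)
        rw [lintegral_const_mul _ hm1]
        congr 1
        rw [lintegral_lintegral_swap]
        · simp_rw [lintegral_sub_right_eq_self]
          simp
        · apply Measurable.aemeasurable
          exact hH.comp (by fun_prop)
      _ = _ := by
        rw [lintegral_mul_const'' _ hW, mul_comm]

lemma hk_interp (f : ℝ → ℂ) (a L : ℝ) (ha : 0 ≤ a) (hL : 0 ≤ L) (p : ℝ≥0∞) (hp : 1 ≤ p)
    (h1 : ∫⁻ x, ‖f x‖ₑ ≤ ENNReal.ofReal a) (h2 : ∀ x, ‖f x‖ₑ ≤ ENNReal.ofReal (a * L)) :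
    eLpNorm f p volume ≤ ENNReal.ofReal (a * L ^ (1 - 1 / p.toReal)) := by
  rcases eq_or_ne p ⊤ with rfl | hpt
  · simp only [eLpNorm_exponent_top, ENNReal.toReal_top, _root_.div_zero, _root_.sub_zero, Real.rpow_one]
    exact eLpNormEssSup_le_of_ae_enorm_bound (ae_of_all _ h2)
  · have hp0 : p ≠ 0 := (zero_lt_one.trans_le hp).ne'
    have hq : 1 ≤ p.toReal := by
      rw [← ENNReal.toReal_one]; exact ENNReal.toReal_mono hpt hp
    set q := p.toReal with hqd
    have hq0 : 0 < q := by linarith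
    rw [eLpNorm_eq_lintegral_rpow_enorm_toReal hp0 hpt, ← hqd]
    have hI : ∫⁻ x, ‖f x‖ₑ ^ q ≤ ENNReal.ofReal ((a * L ^ (1 - 1 / q)) ^ q) := by
      calc ∫⁻ x, ‖f x‖ₑ ^ q ≤ ∫⁻ x, ENNReal.ofReal ((a * L) ^ (q - 1)) * ‖f x‖ₑ := by
            refine lintegral_mono fun x => ?_
            have : ‖f x‖ₑ ^ q = ‖f x‖ₑ ^ (q - 1) * ‖f x‖ₑ := by
              conv_rhs => rw [← ENNReal.rpow_one ‖f x‖ₑ, ← ENNReal.rpow_mul, one_mul,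
                ← ENNReal.rpow_add_of_nonneg _ _ (by linarith) zero_le_one]
              simp
            simp only [this]
            gcongr
            rw [← ENNReal.ofReal_rpow_of_nonneg (by positivity) (by linarith)]
            exact ENNReal.rpow_le_rpow (h2 x) (by linarith)
        _ = ENNReal.ofReal ((a * L) ^ (q - 1)) * ∫⁻ x, ‖f x‖ₑ :=
            lintegral_const_mul' _ _ ENNReal.ofReal_ne_top
        _ ≤ ENNReal.ofReal ((a * L) ^ (q - 1)) * ENNReal.ofReal a := by gcongr
        _ = ENNReal.ofReal ((a * L ^ (1 - 1 / q)) ^ q) := by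
            rw [← ENNReal.ofReal_mul (by positivity)]
            congr 1
            rw [Real.mul_rpow ha hL, Real.mul_rpow ha (by positivity), ← Real.rpow_mul hL]
            have e1 : (1 - 1 / q) * q = q - 1 := by field_simp
            have e2 : a ^ q = a ^ (q - 1) * a := by
              have := Real.rpow_add_one' ha (y := q - 1) (by linarith)
              simpa using this
            rw [e1, e2]; ring
    calc _ ≤ (ENNReal.ofReal ((a * L ^ (1 - 1 / q)) ^ q)) ^ (1 / q) :=
          ENNReal.rpow_le_rpow hI (by positivity)
      _ = _ := by
          rw [ENNReal.ofReal_rpow_of_nonneg (by positivity) (by positivity), ← Real.rpow_mul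
            (by positivity), mul_one_div_cancel hq0.ne', Real.rpow_one]

lemma hk_moment_integrable {u₀ : ℝ → ℂ} {N : ℕ} (hu : Integrable u₀)
    (huN : Integrable (fun x => |x| ^ (N + 1) * u₀ x)) (j : ℕ) (hj : j ≤ N + 1) :
    Integrable (fun x : ℝ => (x : ℂ) ^ j * u₀ x) := by
  refine (hu.norm.add huN.norm).mono' ?_ (ae_of_all _ fun x => ?_)
  · exact (by fun_prop : Continuous fun x : ℝ => (x : ℂ) ^ j).aestronglyMeasurable.mul
      hu.aestronglyMeasurable
  · simp only [Pi.add_apply, norm_mul, norm_pow, Complex.norm_real, Real.norm_eq_abs, abs_abs]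
    rw [← one_add_mul]
    gcongr
    rcases le_total |x| 1 with h | h
    · have := pow_le_one₀ (n := j) (abs_nonneg x) h
      have : 0 ≤ |x| ^ (N + 1) := by positivity
      linarith
    · have := pow_le_pow_right₀ h hj
      linarith

lemma hk_majorant_lintegral (B l : ℝ) (hB : 0 < B) (hl : 0 < l) (n : ℕ) :
    ∫⁻ x : ℝ, ENNReal.ofReal (l⁻¹ ^ (n + 1) * (B * (1 + (x * l⁻¹) ^ 2)⁻¹)) =
      ENNReal.ofReal (l⁻¹ ^ n * (B * Real.pi)) := by
  have hi : Integrable (fun x : ℝ => (1 + (x * l⁻¹) ^ 2)⁻¹) :=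
    integrable_inv_one_add_sq.comp_mul_right' (inv_ne_zero hl.ne')
  rw [← ofReal_integral_eq_lintegral_ofReal ((hi.const_mul B).const_mul _)
    (ae_of_all _ fun x => by positivity), integral_const_mul, integral_const_mul,
    Measure.integral_comp_mul_right (fun x : ℝ => (1 + x ^ 2)⁻¹) l⁻¹, integral_univ_inv_one_add_sq,
    inv_inv, abs_of_pos hl, smul_eq_mul]
  congr 1
  rw [pow_succ]
  field_simp

lemma hk_remainder_eq {m t : ℝ} (hm : 1 ≤ m) (ht : 0 < t) {N : ℕ} {u₀ : ℝ → ℂ}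
    (hu : Integrable u₀) (huN : Integrable (fun x => |x| ^ (N + 1) * u₀ x)) (x : ℝ) :
    convOn (heatKernelGen m t) u₀ x -
            ∑ j ∈ Finset.range (N + 1),
              momentCoeff u₀ j * iteratedDeriv j (fun y => heatKernelGen m t y) x =
    ∫ y : ℝ, (hkD m t 0 (x - y) - ∑ j ∈ Finset.range (N + 1),
        (-(y:ℂ)) ^ j / (Nat.factorial j : ℂ) * hkD m t j x) * u₀ y := by
  have e1 : ∀ j, iteratedDeriv j (fun y => heatKernelGen m t y) x = hkD m t j x := fun j =>
    congrFun (hkD_iteratedDeriv hm ht j) x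
  obtain ⟨B, hB⟩ := hkD_bdd (m := m) (t := t) 0
  have hi1 : Integrable (fun y => hkD m t 0 (x - y) * u₀ y) :=
    hu.bdd_mul (c := B) ((hkD_continuous hm ht 0).comp
      (by fun_prop : Continuous fun y : ℝ => x - y)).aestronglyMeasurable
      (ae_of_all _ fun y => hB _)
  have hi2 : ∀ j ∈ Finset.range (N + 1), Integrable (fun y : ℝ =>
      ((-1 : ℂ) ^ j / (Nat.factorial j : ℂ) * hkD m t j x) * ((y : ℂ) ^ j * u₀ y)) := fun j hj =>
    (hk_moment_integrable hu huN j (Finset.mem_range.mp hj).le).const_mul _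
  have e2 : ∀ y : ℝ, (hkD m t 0 (x - y) - ∑ j ∈ Finset.range (N + 1),
        (-(y:ℂ)) ^ j / (Nat.factorial j : ℂ) * hkD m t j x) * u₀ y =
      hkD m t 0 (x - y) * u₀ y - ∑ j ∈ Finset.range (N + 1),
        ((-1 : ℂ) ^ j / (Nat.factorial j : ℂ) * hkD m t j x) * ((y : ℂ) ^ j * u₀ y) := by
    intro y
    rw [sub_mul, Finset.sum_mul]
    congr 1
    refine Finset.sum_congr rfl fun j _ => ?_
    rw [neg_pow]; ring
  simp_rw [e2, e1]
  rw [integral_sub hi1 (integrable_finsetSum _ hi2), integral_finsetSum _ hi2]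
  simp_rw [integral_const_mul]
  rw [convOn, hkD_zero]
  congr 1
  refine Finset.sum_congr rfl fun j _ => ?_
  rw [momentCoeff]; ring

lemma hk_main (m : ℝ) (hm : 1 ≤ m) (N : ℕ)
    (p : ℝ≥0∞) (hp : 1 ≤ p) :
    ∃ C > 0, ∀ u₀ : ℝ → ℂ, Integrable u₀ →
      Integrable (fun x => |x| ^ (N + 1) * u₀ x) →
      ∀ t : ℝ, 0 < t →
        eLpNorm (fun x => convOn (heatKernelGen m t) u₀ x -
            ∑ j ∈ Finset.range (N + 1),
              momentCoeff u₀ j * iteratedDeriv j (fun y => heatKernelGen m t y) x) p volume ≤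
          ENNReal.ofReal (C * t ^ (-(1 / m) * (1 - 1 / p.toReal) - ((N : ℝ) + 1) / m) *
            ∫ x : ℝ, |x| ^ (N + 1) * ‖u₀ x‖) := by
  obtain ⟨B, hB, hBd⟩ := hkD_bound hm (N + 1) (by omega)
  refine ⟨B * Real.pi, by positivity, fun u₀ hu huN t ht => ?_⟩
  set l := t ^ (1 / m) with hl
  have hlp : 0 < l := Real.rpow_pos_of_pos ht _
  set J := ∫ x : ℝ, |x| ^ (N + 1) * ‖u₀ x‖ with hJ
  have hJ0 : 0 ≤ J := integral_nonneg fun x => by positivity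
  set W : ℝ → ℝ≥0∞ := fun y => ‖y‖ₑ ^ (N + 1) * ‖u₀ y‖ₑ with hW
  have hWm : AEMeasurable W := by
    have := hu.aestronglyMeasurable.enorm
    exact (measurable_enorm.pow_const _).aemeasurable.mul this
  have hWJ : ∫⁻ y, W y = ENNReal.ofReal J := by
    have e : J = ∫ x : ℝ, ‖((|x| : ℝ) : ℂ) ^ (N + 1) * u₀ x‖ := by
      simp [hJ]
    rw [e, ofReal_integral_norm_eq_lintegral_enorm huN]
    refine lintegral_congr fun y => ?_
    rw [enorm_mul, enorm_pow, hW]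
    have e3 : ‖((|y| : ℝ) : ℂ)‖ₑ = ‖y‖ₑ := by
      rw [← ofReal_norm, ← ofReal_norm, Complex.norm_real, norm_abs_eq_norm]
    rw [e3]
  set H : ℝ → ℝ≥0∞ := fun x =>
    ENNReal.ofReal (l⁻¹ ^ (N + 1 + 1) * (B * (1 + (x * l⁻¹) ^ 2)⁻¹)) with hH
  have hHm : Measurable H := by simp only [hH]; fun_prop
  have hDH : ∀ x, ‖hkD m t (N + 1) x‖ₑ ≤ H x := fun x => by
    rw [← ofReal_norm]
    exact ENNReal.ofReal_le_ofReal (hBd t ht x)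
  obtain ⟨b1, b2⟩ := hk_remainder_bounds H W (fun x => convOn (heatKernelGen m t) u₀ x -
            ∑ j ∈ Finset.range (N + 1),
              momentCoeff u₀ j * iteratedDeriv j (fun y => heatKernelGen m t y) x) hHm hWm (by
    intro x
    rw [hk_remainder_eq hm ht hu huN]
    refine (enorm_integral_le_lintegral_enorm _).trans (lintegral_mono fun y => ?_)
    rw [enorm_mul]
    calc _ ≤ (‖y‖ₑ ^ (N + 1) * ∫⁻ s in Ioc (0:ℝ) 1, ‖hkD m t (N + 1) (x - s * y)‖ₑ) * ‖u₀ y‖ₑ := by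
          gcongr
          exact hk_taylor_bound (hkD m t) (fun j x => hkD_hasDerivAt hm ht j x) x y N
      _ ≤ (‖y‖ₑ ^ (N + 1) * ∫⁻ s in Ioc (0:ℝ) 1, H (x - s * y)) * ‖u₀ y‖ₑ := by
          gcongr
          exact hDH _
      _ = _ := by simp only [hW]; ring)
  have hint := hk_majorant_lintegral B l hB hlp (N + 1)
  have hb2 := b2
  rw [hint, hWJ, ← ENNReal.ofReal_mul (by positivity)] at hb2
  have hb1 := b1 (ENNReal.ofReal (l⁻¹ ^ (N + 1) * (B * Real.pi) * l⁻¹)) ENNReal.ofReal_ne_top (by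
    intro x
    apply ENNReal.ofReal_le_ofReal
    have h1 : (1 + (x * l⁻¹) ^ 2)⁻¹ ≤ 1 := inv_le_one_of_one_le₀ (by nlinarith [sq_nonneg (x * l⁻¹)])
    have h2 : (1:ℝ) ≤ Real.pi := by linarith [Real.pi_gt_three]
    have h3 : (1 + (x * l⁻¹) ^ 2)⁻¹ ≤ Real.pi := h1.trans h2
    calc l⁻¹ ^ (N + 1 + 1) * (B * (1 + (x * l⁻¹) ^ 2)⁻¹) ≤ l⁻¹ ^ (N + 1 + 1) * (B * Real.pi) := by
          gcongr
      _ = _ := by ring)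
  rw [hWJ] at hb1
  refine (hk_interp _ (l⁻¹ ^ (N + 1) * (B * Real.pi) * J) l⁻¹ (by positivity) (by positivity) p hp
    hb2 fun x => ?_).trans (le_of_eq ?_)
  · refine (hb1 x).trans (le_of_eq ?_)
    rw [← ENNReal.ofReal_mul (by positivity)]
    congr 1; ring
  · congr 1
    have e1 : l⁻¹ = t ^ (-(1 / m)) := by rw [hl, Real.rpow_neg ht.le]
    have e2 : l⁻¹ ^ (N + 1) * l⁻¹ ^ (1 - 1 / p.toReal) =
        t ^ (-(1 / m) * (1 - 1 / p.toReal) - ((N : ℝ) + 1) / m) := by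
      rw [e1, ← Real.rpow_natCast, ← Real.rpow_mul ht.le, ← Real.rpow_mul ht.le,
        ← Real.rpow_add ht]
      congr 1
      push_cast
      ring
    rw [← e2]; ring

end HeatAux

theorem heat_asymptotic_expansion (m : ℝ) (hm : 1 ≤ m) (N : ℕ)
    (p : ℝ≥0∞) (hp : 1 ≤ p) :
    ∃ C > 0, ∀ u₀ : ℝ → ℂ, Integrable u₀ →
      Integrable (fun x => |x| ^ (N + 1) * u₀ x) →
      ∀ t : ℝ, 0 < t →
        eLpNorm (fun x => convOn (heatKernelGen m t) u₀ x -
            ∑ j ∈ Finset.range (N + 1),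
              momentCoeff u₀ j * iteratedDeriv j (fun y => heatKernelGen m t y) x) p volume ≤
          ENNReal.ofReal (C * t ^ (-(1 / m) * (1 - 1 / p.toReal) - ((N : ℝ) + 1) / m) *
            ∫ x : ℝ, |x| ^ (N + 1) * ‖u₀ x‖) := by
  exact hk_main m hm N p hp
end

section
/- Let m ≥ 1 and let S(t)v₀ be defined on the Fourier side by (S(t)v₀)^(ξ) = e^{−tΦ(ξ)} v̂₀(ξ) with Φ(ξ) = (|ξ|^m − iξ|ξ|^m)/(1+|ξ|^m). Then for v₀ ∈ W^{1,1}(ℝ) there exists C > 0 independent of t such that ‖S(t)v₀‖_{L²(ℝ)} ≤ C ‖v₀‖_{W^{1,1}} (1+t)^{−1/(2m)} for all t ≥ 0. -/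
open MeasureTheory Real FourierTransform Complex

/-- Phase function `Φ(ξ) = (|ξ|^m − iξ|ξ|^m)/(1+|ξ|^m)`. -/
noncomputable def phaseFn (m : ℝ) (ξ : ℝ) : ℂ :=
  (((|ξ| ^ m : ℝ) : ℂ) - Complex.I * ξ * ((|ξ| ^ m : ℝ) : ℂ)) / (1 + ((|ξ| ^ m : ℝ) : ℂ))

theorem neg_inner_cont :
    Continuous fun p : ℝ × ℝ => (-innerₗ ℝ : ℝ →ₗ[ℝ] ℝ →ₗ[ℝ] ℝ) p.1 p.2 := by
  have : Continuous fun p : ℝ × ℝ => -(p.2 * p.1) := by fun_prop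
  simpa using! this

open scoped SchwartzMap ContDiff in
/-- Plancherel for functions in `L¹ ∩ L²`, inverse Fourier integral. -/
theorem plancherel_aux (g : ℝ → ℂ) (h1 : Integrable g) (h2 : MemLp g 2 volume) :
    eLpNorm (𝓕⁻ g) 2 volume = eLpNorm g 2 volume := by
  have hcont : Continuous (𝓕⁻ g) :=
    VectorFourier.fourierIntegral_continuous (L := -innerₗ ℝ) Real.continuous_fourierChar
      neg_inner_cont h1
  have hae : ∀ᵐ x : ℝ, (𝓕⁻ (h2.toLp g) : Lp ℂ 2 (volume : Measure ℝ)) x = 𝓕⁻ g x := by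
    apply ae_eq_of_integral_contDiff_smul_eq
    · exact (Lp.memLp _).locallyIntegrable (by norm_num)
    · exact hcont.locallyIntegrable
    · intro φ hφ hc
      have hg₁ : HasCompactSupport (Complex.ofRealCLM ∘ φ) := hc.comp_left rfl
      have hg₂ : ContDiff ℝ ∞ (Complex.ofRealCLM ∘ φ) := by fun_prop
      set ψ : 𝓢(ℝ, ℂ) := hg₁.toSchwartzMap hg₂ with hψ
      have e1 : ∫ x, φ x • (𝓕⁻ (h2.toLp g) : Lp ℂ 2 (volume : Measure ℝ)) x
          = Lp.toTemperedDistribution (𝓕⁻ (h2.toLp g) : Lp ℂ 2 (volume : Measure ℝ)) ψ := by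
        simp [hψ]
      rw [e1, ← Lp.fourierInv_toTemperedDistribution_eq, TemperedDistribution.fourierInv_apply,
        Lp.toTemperedDistribution_apply]
      have e2 : ∫ x, (𝓕⁻ ψ) x • (h2.toLp g) x = ∫ x, (𝓕⁻ (ψ : ℝ → ℂ)) x • g x := by
        apply integral_congr_ae
        filter_upwards [h2.coeFn_toLp] with x hx
        rw [hx, SchwartzMap.fourierInv_coe]
      rw [e2]
      have := VectorFourier.integral_fourierIntegral_smul_eq_flip (L := -innerₗ ℝ)
        (μ := volume) (ν := volume) Real.continuous_fourierChar
        neg_inner_cont ψ.integrable h1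
      have hfl : (-innerₗ ℝ : ℝ →ₗ[ℝ] ℝ →ₗ[ℝ] ℝ).flip = -innerₗ ℝ := by
        ext; simp
      rw [hfl] at this
      refine this.trans ?_
      apply integral_congr_ae
      filter_upwards with x
      simp [hψ]
      left; rfl
  rw [← eLpNorm_congr_ae (f := (𝓕⁻ (h2.toLp g) : Lp ℂ 2 (volume : Measure ℝ))) hae]
  have hn : ‖(𝓕⁻ (h2.toLp g) : Lp ℂ 2 (volume : Measure ℝ))‖ = ‖h2.toLp g‖ :=
    (Lp.fourierTransformₗᵢ ℝ ℂ).symm.norm_map _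
  have hn' := congrArg ENNReal.ofReal hn
  rw [Lp.norm_def, Lp.norm_def, ENNReal.ofReal_toReal (Lp.eLpNorm_ne_top _),
    ENNReal.ofReal_toReal (Lp.eLpNorm_ne_top _)] at hn'
  rw [hn', eLpNorm_congr_ae h2.coeFn_toLp]

theorem exp_aux (m : ℝ) (hm : 1 ≤ m) (b : ℝ) (hb : 0 < b) :
    Integrable (fun ξ : ℝ => Real.exp (-b * |ξ| ^ m)) ∧
    ∫ ξ : ℝ, Real.exp (-b * |ξ| ^ m) = 2 * (b ^ (-1 / m) * Real.Gamma (1 / m + 1)) := by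
  have hm0 : 0 < m := by linarith
  constructor
  · have := integrableOn_rpow_mul_exp_neg_mul_rpow (s := 0) (by norm_num) hm0 hb
    simp only [Real.rpow_zero, one_mul] at this
    have hI : IntegrableOn (fun x : ℝ => Real.exp (-b * |x| ^ m)) (Set.Ioi 0) := by
      refine this.congr_fun (fun x hx => ?_) measurableSet_Ioi
      simp only [abs_of_pos (Set.mem_Ioi.1 hx)]
    have hJ : IntegrableOn (fun x : ℝ => Real.exp (-b * |x| ^ m)) (Set.Iic 0) := by
      rw [← Measure.map_neg_eq_self (volume : Measure ℝ)]
      let e : MeasurableEmbedding fun x : ℝ => -x := (Homeomorph.neg ℝ).measurableEmbedding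
      rw [e.integrableOn_map_iff]
      simp_rw [Function.comp_def, abs_neg, Set.neg_preimage, Set.neg_Iic, neg_zero]
      exact Iff.mpr integrableOn_Ici_iff_integrableOn_Ioi hI
    have hu := hJ.union hI
    rwa [Set.Iic_union_Ioi, integrableOn_univ] at hu
  · rw [integral_comp_abs (f := fun x => Real.exp (-b * x ^ m)),
      _root_.integral_exp_neg_mul_rpow hm0 hb]

theorem phaseFn_re (m ξ : ℝ) : (phaseFn m ξ).re = |ξ| ^ m / (1 + |ξ| ^ m) := by
  have h : phaseFn m ξ = ((|ξ| ^ m / (1 + |ξ| ^ m) : ℝ) : ℂ)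
      + ((-(ξ * |ξ| ^ m / (1 + |ξ| ^ m)) : ℝ) : ℂ) * Complex.I := by
    unfold phaseFn
    push_cast
    ring
  rw [h, Complex.add_re, Complex.re_ofReal_mul, Complex.ofReal_re, Complex.I_re, mul_zero, add_zero]

theorem pointwise_aux (m : ℝ) (hm : 1 ≤ m) (t : ℝ) (ht : 0 ≤ t) (ξ N : ℝ) (z : ℂ)
    (h1 : ‖z‖ ≤ N) (h2 : |ξ| * ‖z‖ ≤ N) :
    ‖Complex.exp (-(t : ℂ) * phaseFn m ξ) * z‖ ^ 2 ≤
      N ^ 2 * (Real.exp 1 * Real.exp (-(1 + t) * |ξ| ^ m)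
        + 2 * (1 + t) ^ (-1 / m) * (1 + ξ ^ 2)⁻¹) := by
  have hm0 : 0 < m := by linarith
  have hN : 0 ≤ N := (norm_nonneg z).trans h1
  have hre : (-(t : ℂ) * phaseFn m ξ).re = -t * (|ξ| ^ m / (1 + |ξ| ^ m)) := by
    rw [← phaseFn_re, ← Complex.ofReal_neg, Complex.re_ofReal_mul]
  rw [norm_mul, Complex.norm_exp, hre, mul_pow, ← Real.exp_nat_mul]
  have hr0 : 0 ≤ |ξ| ^ m := Real.rpow_nonneg (abs_nonneg _) _
  have ht1 : 0 ≤ (1 + t) ^ (-1 / m) := Real.rpow_nonneg (by linarith) _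
  have hxi : 0 < (1 + ξ ^ 2)⁻¹ := by positivity
  rcases le_total |ξ| 1 with h | h
  · have hr1 : |ξ| ^ m ≤ 1 := Real.rpow_le_one (abs_nonneg _) h hm0.le
    generalize |ξ| ^ m = r at *
    have hd : r / 2 ≤ r / (1 + r) := by
      apply div_le_div_of_nonneg_left hr0 <;> linarith
    have : Real.exp ((2 : ℕ) * (-t * (r / (1 + r)))) ≤ Real.exp 1 * Real.exp (-(1 + t) * r) := by
      rw [← Real.exp_add]
      apply Real.exp_le_exp.2
      push_cast
      nlinarith [mul_le_mul_of_nonneg_left hd ht]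
    calc _ ≤ (Real.exp 1 * Real.exp (-(1 + t) * r)) * N ^ 2 := by gcongr
      _ ≤ _ := by
        have : 0 ≤ N ^ 2 * (2 * (1 + t) ^ (-1 / m) * (1 + ξ ^ 2)⁻¹) := by positivity
        linarith
  · have hr1 : 1 ≤ |ξ| ^ m := Real.one_le_rpow h hm0.le
    generalize |ξ| ^ m = r at *
    have hd : 1 / 2 ≤ r / (1 + r) := by
      rw [div_le_div_iff₀] <;> linarith
    have h3 : Real.exp ((2 : ℕ) * (-t * (r / (1 + r)))) ≤ (1 + t) ^ (-1 / m) := by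
      calc _ ≤ Real.exp (-t) := by
            apply Real.exp_le_exp.2
            push_cast
            nlinarith [mul_le_mul_of_nonneg_left hd ht]
        _ ≤ (1 + t) ^ (-1 : ℝ) := by
            rw [Real.exp_neg, Real.rpow_neg_one]
            apply inv_anti₀ (by linarith)
            linarith [Real.add_one_le_exp t]
        _ ≤ _ := by
            apply Real.rpow_le_rpow_of_exponent_le (by linarith)
            rw [le_div_iff₀ hm0]; linarith
    have h4 : ‖z‖ ^ 2 ≤ N ^ 2 * (2 * (1 + ξ ^ 2)⁻¹) := by
      have : (|ξ| * ‖z‖) ^ 2 ≤ N ^ 2 := by gcongr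
      rw [mul_pow, sq_abs] at this
      have hz : ‖z‖ ^ 2 ≤ N ^ 2 := by gcongr
      rw [← mul_assoc, ← div_eq_mul_inv, le_div_iff₀ (by positivity)]
      linarith
    calc _ ≤ (1 + t) ^ (-1 / m) * (N ^ 2 * (2 * (1 + ξ ^ 2)⁻¹)) := by gcongr
      _ ≤ _ := by
        have : 0 ≤ N ^ 2 * (Real.exp 1 * Real.exp (-(1 + t) * r)) := by positivity
        linarith

theorem semigroup_L2_decay (m : ℝ) (hm : 1 ≤ m) :
    ∃ C > 0, ∀ v₀ : ℝ → ℂ, Integrable v₀ → Differentiable ℝ v₀ →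
      Integrable (deriv v₀) →
      ∀ t : ℝ, 0 ≤ t →
        eLpNorm (𝓕⁻ (fun ξ : ℝ => Complex.exp (-(t : ℂ) * phaseFn m ξ) * 𝓕 v₀ ξ)) 2 volume ≤
          ENNReal.ofReal (C * ((∫ x : ℝ, ‖v₀ x‖) + ∫ x : ℝ, ‖deriv v₀ x‖) *
            (1 + t) ^ (-(1 / (2 * m)))) := by
  have hm0 : 0 < m := by linarith
  have hG : 0 < Real.Gamma (1 / m + 1) := Real.Gamma_pos_of_pos (by positivity)
  refine ⟨√(2 * Real.exp 1 * Real.Gamma (1 / m + 1) + 2 * π), by positivity, ?_⟩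
  intro v hv hd hv' t ht
  set K := 2 * Real.exp 1 * Real.Gamma (1 / m + 1) + 2 * π with hK
  have hK0 : 0 < K := by positivity
  set N := (∫ x : ℝ, ‖v x‖) + ∫ x : ℝ, ‖deriv v x‖ with hN
  set g : ℝ → ℂ := fun ξ : ℝ => Complex.exp (-(t : ℂ) * phaseFn m ξ) * 𝓕 v ξ with hg
  have i1 : 0 ≤ ∫ x : ℝ, ‖v x‖ := integral_nonneg fun _ => norm_nonneg _
  have i2 : 0 ≤ ∫ x : ℝ, ‖deriv v x‖ := integral_nonneg fun _ => norm_nonneg _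
  have hN0 : 0 ≤ N := by positivity
  by_cases hgi : Integrable g
  swap
  · have : 𝓕⁻ g = 0 := by
      ext x
      rw [Real.fourierInv_eq]
      apply integral_undef
      intro h
      apply hgi
      have := (VectorFourier.fourierIntegral_convergent_iff (μ := volume) (f := g)
        (L := -innerₗ ℝ) Real.continuous_fourierChar
        neg_inner_cont x).1
      apply this
      simpa using! h
    rw [this]; simp
  have hb : ∀ ξ, ‖g ξ‖ ^ 2 ≤ N ^ 2 * (Real.exp 1 * Real.exp (-(1 + t) * |ξ| ^ m)
        + 2 * (1 + t) ^ (-1 / m) * (1 + ξ ^ 2)⁻¹) := by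
    intro ξ
    apply pointwise_aux m hm t ht
    · have : ‖𝓕 v ξ‖ ≤ ∫ x : ℝ, ‖v x‖ :=
        VectorFourier.norm_fourierIntegral_le_integral_norm _ _ _ _ _
      linarith
    · have h1 : ‖𝓕 (deriv v) ξ‖ ≤ ∫ x : ℝ, ‖deriv v x‖ :=
        VectorFourier.norm_fourierIntegral_le_integral_norm _ _ _ _ _
      rw [Real.fourier_deriv hv hd hv'] at h1
      simp only [norm_smul, norm_mul, Complex.norm_real, Complex.norm_I, Real.norm_eq_abs,
        abs_of_pos Real.pi_pos, mul_one, Complex.norm_two] at h1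
      have h2 : 0 ≤ |ξ| * ‖𝓕 v ξ‖ := by positivity
      nlinarith [Real.pi_gt_three]
  obtain ⟨e1, e2⟩ := exp_aux m hm (1 + t) (by linarith)
  have hFi : Integrable (fun ξ : ℝ => N ^ 2 * (Real.exp 1 * Real.exp (-(1 + t) * |ξ| ^ m)
        + 2 * (1 + t) ^ (-1 / m) * (1 + ξ ^ 2)⁻¹)) :=
    ((e1.const_mul _).add (integrable_inv_one_add_sq.const_mul _)).const_mul _
  have hFv : ∫ ξ : ℝ, N ^ 2 * (Real.exp 1 * Real.exp (-(1 + t) * |ξ| ^ m)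
        + 2 * (1 + t) ^ (-1 / m) * (1 + ξ ^ 2)⁻¹) = N ^ 2 * (K * (1 + t) ^ (-1 / m)) := by
    rw [integral_const_mul, integral_add (e1.const_mul _) (integrable_inv_one_add_sq.const_mul _),
      integral_const_mul, integral_const_mul, e2, integral_univ_inv_one_add_sq, hK]
    ring
  have hsq : Integrable (fun ξ => ‖g ξ‖ ^ 2) := by
    refine hFi.mono' (hgi.aestronglyMeasurable.norm.pow 2) ?_
    filter_upwards with ξ
    rw [Real.norm_of_nonneg (by positivity)]
    exact hb ξ
  have hL2 : MemLp g 2 volume :=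
    (memLp_two_iff_integrable_sq_norm hgi.aestronglyMeasurable).2 hsq
  rw [plancherel_aux g hgi hL2, hL2.eLpNorm_eq_integral_rpow_norm (by norm_num) (by norm_num)]
  apply ENNReal.ofReal_le_ofReal
  have hle : ∫ ξ, ‖g ξ‖ ^ 2 ≤ N ^ 2 * (K * (1 + t) ^ (-1 / m)) := by
    rw [← hFv]
    exact integral_mono hsq hFi hb
  have hr : (√K * N * (1 + t) ^ (-(1 / (2 * m)))) ^ 2 = N ^ 2 * (K * (1 + t) ^ (-1 / m)) := by
    rw [mul_pow, mul_pow, Real.sq_sqrt hK0.le, ← Real.rpow_natCast (_ ^ _),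
      ← Real.rpow_mul (by linarith)]
    have : -(1 / (2 * m)) * ((2 : ℕ) : ℝ) = -1 / m := by
      push_cast; field_simp
    rw [this]; ring
  have hp : 0 ≤ (1 + t) ^ (-(1 / (2 * m))) := Real.rpow_nonneg (by linarith) _
  simp only [ENNReal.toReal_ofNat, Real.rpow_ofNat]
  rw [← one_div, ← Real.sqrt_eq_rpow]
  apply Real.sqrt_le_iff.2
  exact ⟨by positivity, by rw [hr]; exact hle⟩
end

section
/- Let m > 3/2 and set K̂_m(ξ) = 1/(1+|ξ|^m). Define S(t)K_m on the Fourier side by (S(t)K_m)^(ξ) = e^{−tΦ(ξ)}/(1+|ξ|^m) with Φ(ξ) = (|ξ|^m − iξ|ξ|^m)/(1+|ξ|^m). Then there exists C > 0 independent of t such that for all t ≥ 0: ‖S(t)K_m‖_{L²} ≤ C(1+t)^{−1/(2m)}, ‖∂_x S(t)K_m‖_{L²} ≤ C(1+t)^{−1/(2m) − 1/m}, and ‖S(t)K_m‖_{L^∞} ≤ C(1+t)^{−1/m}. -/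
open MeasureTheory Real FourierTransform Complex

/-- `S(t)K_m`, defined on the Fourier side by `e^{−tΦ(ξ)}/(1+|ξ|^m)`. -/
noncomputable def semigroupKernel (m t : ℝ) : ℝ → ℂ :=
  𝓕⁻ (fun ξ : ℝ => Complex.exp (-(t : ℂ) * phaseFn m ξ) / (1 + ((|ξ| ^ m : ℝ) : ℂ)))


lemma skd_plancherel (f : ℝ → ℂ) (h1 : Integrable f) (h2 : MemLp f 2) :
    eLpNorm (𝓕⁻ f) 2 volume = eLpNorm f 2 volume := by
  set F : Lp ℂ 2 (volume : Measure ℝ) := h2.toLp f with hF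
  have hcont : Continuous (𝓕⁻ f) := by
    have := VectorFourier.fourierIntegral_continuous (L := -innerₗ ℝ) (e := 𝐞) (μ := (volume : Measure ℝ))
      continuous_fourierChar (by simp only [LinearMap.neg_apply, innerₗ_apply_apply]; fun_prop) h1
    exact this
  have key : ∀ᵐ x, (𝓕⁻ f) x = (𝓕⁻ F : Lp ℂ 2 (volume : Measure ℝ)) x := by
    apply ae_eq_of_integral_contDiff_smul_eq hcont.locallyIntegrable
      ((Lp.memLp _).locallyIntegrable (by norm_num))
    intro g g_smooth g_cpt
    have hg₁ : HasCompactSupport (Complex.ofRealCLM ∘ g) := g_cpt.comp_left rfl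
    have hg₂ : ContDiff ℝ (⊤ : ℕ∞) (Complex.ofRealCLM ∘ g) := by fun_prop
    set G := hg₁.toSchwartzMap hg₂ with hG
    have e1 : ∫ x, g x • (𝓕⁻ F : Lp ℂ 2 (volume : Measure ℝ)) x
        = Lp.toTemperedDistribution (𝓕⁻ F : Lp ℂ 2 (volume : Measure ℝ)) G := by
      rw [Lp.toTemperedDistribution_apply]; simp [hG]
    rw [e1, ← Lp.fourierInv_toTemperedDistribution_eq, TemperedDistribution.fourierInv_apply,
      Lp.toTemperedDistribution_apply]
    have e2 : ∫ x, g x • (𝓕⁻ f) x = ∫ x, (𝓕⁻ f) x • G x := by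
      simp [hG, mul_comm]
    have e3 := VectorFourier.integral_fourierIntegral_smul_eq_flip (L := -innerₗ ℝ) (e := 𝐞)
      (μ := (volume : Measure ℝ)) (ν := (volume : Measure ℝ)) (g := (G : ℝ → ℂ))
      continuous_fourierChar (by simp only [LinearMap.neg_apply, innerₗ_apply_apply]; fun_prop) h1 G.integrable
    rw [e2]
    refine Eq.trans e3 ?_
    apply integral_congr_ae
    filter_upwards [h2.coeFn_toLp] with x hx
    rw [hF, hx, SchwartzMap.fourierInv_coe, smul_eq_mul, smul_eq_mul, mul_comm]
    congr 1
    rw [show (-innerₗ ℝ).flip = -innerₗ ℝ by ext; simp]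
    rfl
  rw [eLpNorm_congr_ae key]
  have : ‖(𝓕⁻ F : Lp ℂ 2 (volume : Measure ℝ))‖ = ‖F‖ := (Lp.fourierTransformₗᵢ ℝ ℂ).symm.norm_map F
  have h3 : ‖(𝓕⁻ F : Lp ℂ 2 (volume : Measure ℝ))‖ₑ = ‖F‖ₑ := by
    rw [← ofReal_norm, ← ofReal_norm, this]
  rw [Lp.enorm_def, Lp.enorm_def] at h3
  rw [h3]
  exact eLpNorm_congr_ae h2.coeFn_toLp

lemma skd_exp_le (p : ℝ) : ∃ C > 0, ∀ T : ℝ, 1 ≤ T → Real.exp (-(T / 2)) ≤ C * T ^ (-p) := by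
  obtain ⟨n, hn⟩ := exists_nat_ge p
  refine ⟨2 ^ n * n.factorial, by positivity, fun T hT => ?_⟩
  have hT0 : 0 < T := by linarith
  have h1 := Real.pow_div_factorial_le_exp (T / 2) (by positivity) n
  have h2 : T ^ p ≤ T ^ n := by
    rw [← Real.rpow_natCast]; exact Real.rpow_le_rpow_of_exponent_le hT hn
  rw [Real.exp_neg, Real.rpow_neg hT0.le, inv_le_iff_one_le_mul₀ (Real.exp_pos _)]
  have h3 : 0 < T ^ p := by positivity
  have h4 : T ^ p ≤ 2 ^ n * n.factorial * Real.exp (T / 2) := by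
    rw [div_pow, div_div, div_le_iff₀ (by positivity)] at h1
    linarith
  rw [mul_right_comm, ← div_eq_mul_inv, le_div_iff₀ h3]; linarith

lemma skd_int_abs {f : ℝ → ℝ} (hf : IntegrableOn f (Set.Ioi 0)) :
    Integrable (fun x : ℝ => f |x|) := by
  have h1 : IntegrableOn (fun x : ℝ => f |x|) (Set.Ioi 0) :=
    hf.congr_fun (fun x hx => by rw [abs_of_pos hx]) measurableSet_Ioi
  have h2 : IntegrableOn (fun x : ℝ => f |x|) (Set.Iic 0) := by
    rw [← Measure.map_neg_eq_self (volume : Measure ℝ)]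
    let m : MeasurableEmbedding fun x : ℝ => -x := (Homeomorph.neg ℝ).measurableEmbedding
    rw [m.integrableOn_map_iff]
    simp_rw [Function.comp_def, abs_neg, Set.neg_preimage, Set.neg_Iic, neg_zero]
    exact Iff.mpr integrableOn_Ici_iff_integrableOn_Ioi h1
  rw [← integrableOn_univ, ← Set.Iic_union_Ioi (a := (0 : ℝ))]
  exact h2.union h1

noncomputable def skdF (m q : ℝ) (k : ℕ) (s ξ : ℝ) : ℝ :=
  |ξ| ^ q * Real.exp (-s * (|ξ| ^ m / (1 + |ξ| ^ m))) / (1 + |ξ| ^ m) ^ k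

lemma skd_base (m q : ℝ) (k : ℕ) (hm : 0 < m) (hq : 0 ≤ q) (h : q + 1 < m * k) :
    Integrable (fun ξ : ℝ => |ξ| ^ q / (1 + |ξ| ^ m) ^ k) := by
  have hi := (integrable_one_add_norm (E := ℝ) (μ := volume) (r := m * k - q)
    (by simp; linarith)).const_mul (((2 : ℝ) ^ m) ^ k)
  refine hi.mono' (Measurable.aestronglyMeasurable (by fun_prop)) (Filter.Eventually.of_forall fun ξ => ?_)
  have hx : 0 ≤ |ξ| := abs_nonneg ξ
  rw [Real.norm_of_nonneg (by positivity), Real.norm_eq_abs, neg_sub,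
    Real.rpow_sub (by positivity), Real.rpow_mul (by positivity), Real.rpow_natCast]
  have h1 : (1 + |ξ|) ^ m ≤ 2 ^ m * (1 + |ξ| ^ m) := by
    have a1 : 1 + |ξ| ≤ 2 * max 1 |ξ| := by
      have := le_max_left 1 |ξ|; have := le_max_right 1 |ξ|; linarith
    calc (1 + |ξ|) ^ m ≤ (2 * max 1 |ξ|) ^ m := Real.rpow_le_rpow (by positivity) a1 hm.le
      _ = 2 ^ m * (max 1 |ξ|) ^ m := Real.mul_rpow (by positivity) (by positivity)
      _ ≤ _ := by
        gcongr
        have := Real.rpow_nonneg hx m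
        rcases max_cases 1 |ξ| with ⟨h, _⟩ | ⟨h, _⟩ <;> rw [h] <;> simp <;> linarith
  have h2 : |ξ| ^ q ≤ (1 + |ξ|) ^ q := Real.rpow_le_rpow hx (by linarith) hq
  have h3 : ((1 + |ξ|) ^ m) ^ k ≤ (2 ^ m) ^ k * (1 + |ξ| ^ m) ^ k := by
    rw [← mul_pow]; gcongr
  rw [← mul_div_assoc, div_le_div_iff₀ (by positivity) (by positivity)]
  calc |ξ| ^ q * ((1 + |ξ|) ^ m) ^ k ≤ (1 + |ξ|) ^ q * ((2 ^ m) ^ k * (1 + |ξ| ^ m) ^ k) := by gcongr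
    _ = _ := by ring

lemma skd_est (m q : ℝ) (k : ℕ) (hm : 0 < m) (hq : 0 ≤ q) (h : q + 1 < m * k) :
    ∃ C > 0, ∀ s : ℝ, 0 ≤ s → Integrable (skdF m q k s) ∧
      ∫ ξ, skdF m q k s ξ ≤ C * (1 + s) ^ (-((q + 1) / m)) := by
  obtain ⟨C1, hC1, hexp⟩ := skd_exp_le ((q + 1) / m)
  have hb := skd_base m q k hm hq h
  set B := ∫ ξ : ℝ, |ξ| ^ q / (1 + |ξ| ^ m) ^ k with hB
  have hB0 : 0 ≤ B := integral_nonneg fun ξ => by positivity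
  set G := 2 * ((1 / 2 : ℝ) ^ (-(q + 1) / m) * (1 / m) * Real.Gamma ((q + 1) / m)) with hG
  have hG0 : 0 < G := by
    have : 0 < Real.Gamma ((q + 1) / m) := Real.Gamma_pos_of_pos (by positivity)
    positivity
  refine ⟨Real.exp 1 * (G + C1 * B), by positivity, fun s hs => ?_⟩
  have hT : 1 ≤ 1 + s := by linarith
  have hT0 : 0 < 1 + s := by linarith
  have hI0 := integrableOn_rpow_mul_exp_neg_mul_rpow (p := m) (s := q) (b := (1 + s) / 2)
    (by linarith) hm (by positivity)
  have hI := skd_int_abs hI0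
  have hIv := integral_comp_abs (f := fun x => x ^ q * Real.exp (-((1 + s) / 2) * x ^ m))
  rw [_root_.integral_rpow_mul_exp_neg_mul_rpow hm (by linarith) (by positivity)] at hIv
  have hdom := (hI.add (hb.const_mul (Real.exp (-((1 + s) / 2))))).const_mul (Real.exp 1)
  have hpt : ∀ ξ, skdF m q k s ξ ≤ Real.exp 1 * (|ξ| ^ q * Real.exp (-((1 + s) / 2) * |ξ| ^ m)
      + Real.exp (-((1 + s) / 2)) * (|ξ| ^ q / (1 + |ξ| ^ m) ^ k)) := by
    intro ξ
    have hy : 0 ≤ |ξ| ^ m := by positivity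
    unfold skdF
    set y := |ξ| ^ m
    have hden : 1 ≤ (1 + y) ^ k := one_le_pow₀ (by linarith)
    rcases le_total y 1 with h1 | h1
    · have ha : y / 2 ≤ y / (1 + y) := by gcongr; linarith
      have ha1 : y / (1 + y) ≤ 1 := by rw [div_le_one (by positivity)]; linarith
      have : Real.exp (-s * (y / (1 + y))) ≤ Real.exp 1 * Real.exp (-((1 + s) / 2) * y) := by
        rw [← Real.exp_add]; apply Real.exp_le_exp.2; nlinarith
      calc _ ≤ |ξ| ^ q * Real.exp (-s * (y / (1 + y))) := div_le_self (by positivity) hden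
        _ ≤ |ξ| ^ q * (Real.exp 1 * Real.exp (-((1 + s) / 2) * y)) := by gcongr
        _ = Real.exp 1 * (|ξ| ^ q * Real.exp (-((1 + s) / 2) * y)) := by ring
        _ ≤ _ := by
          gcongr
          have : 0 ≤ Real.exp (-((1 + s) / 2)) * (|ξ| ^ q / (1 + y) ^ k) := by positivity
          linarith
    · have ha : 1 / 2 ≤ y / (1 + y) := by
        rw [div_le_div_iff₀ (by positivity) (by positivity)]; linarith
      have : Real.exp (-s * (y / (1 + y))) ≤ Real.exp 1 * Real.exp (-((1 + s) / 2)) := by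
        rw [← Real.exp_add]; apply Real.exp_le_exp.2; nlinarith
      calc _ = Real.exp (-s * (y / (1 + y))) * (|ξ| ^ q / (1 + y) ^ k) := by ring
        _ ≤ (Real.exp 1 * Real.exp (-((1 + s) / 2))) * (|ξ| ^ q / (1 + y) ^ k) := by gcongr
        _ = Real.exp 1 * (Real.exp (-((1 + s) / 2)) * (|ξ| ^ q / (1 + y) ^ k)) := by ring
        _ ≤ _ := by
          gcongr
          have : 0 ≤ |ξ| ^ q * Real.exp (-((1 + s) / 2) * y) := by positivity
          linarith
  have hnn : ∀ ξ, 0 ≤ skdF m q k s ξ := fun ξ => by unfold skdF; positivity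
  have hint : Integrable (skdF m q k s) := by
    refine hdom.mono' (Measurable.aestronglyMeasurable (by unfold skdF; fun_prop))
      (Filter.Eventually.of_forall fun ξ => ?_)
    rw [Real.norm_of_nonneg (hnn ξ)]; exact hpt ξ
  refine ⟨hint, (integral_mono hint hdom hpt).trans ?_⟩
  simp only [Pi.add_apply]
  rw [integral_const_mul, integral_add hI (hb.const_mul _), integral_const_mul, hIv, ← hB]
  have e1 : 2 * (((1 + s) / 2) ^ (-(q + 1) / m) * (1 / m) * Real.Gamma ((q + 1) / m))
      = G * (1 + s) ^ (-((q + 1) / m)) := by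
    rw [hG, div_eq_mul_one_div (1 + s) 2, Real.mul_rpow hT0.le (by norm_num), neg_div]; ring
  rw [e1, mul_assoc (Real.exp 1), add_mul]
  refine mul_le_mul_of_nonneg_left (add_le_add le_rfl ?_) (Real.exp_pos _).le
  calc _ ≤ (C1 * (1 + s) ^ (-((q + 1) / m))) * B := mul_le_mul_of_nonneg_right (hexp _ hT) hB0
    _ = _ := by ring

lemma skd_L2 (g : ℝ → ℂ) (A : ℝ) (hi : Integrable (fun x => ‖g x‖ ^ 2)) (hA : ∫ x, ‖g x‖ ^ 2 ≤ A) :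
    eLpNorm g 2 volume ≤ ENNReal.ofReal (A ^ (1 / 2 : ℝ)) := by
  have hA0 : 0 ≤ A := le_trans (integral_nonneg fun x => by positivity) hA
  rw [eLpNorm_eq_lintegral_rpow_enorm_toReal (by norm_num) (by norm_num),
    ← ENNReal.ofReal_rpow_of_nonneg hA0 (by norm_num)]
  simp only [ENNReal.toReal_ofNat]
  gcongr
  calc ∫⁻ x, ‖g x‖ₑ ^ (2 : ℝ) = ∫⁻ x, ENNReal.ofReal (‖g x‖ ^ 2) := by
        congr 1; ext x
        rw [ENNReal.ofReal_pow (norm_nonneg _), ofReal_norm, ← ENNReal.rpow_natCast]; norm_num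
    _ = ENNReal.ofReal (∫ x, ‖g x‖ ^ 2) :=
        (ofReal_integral_eq_lintegral_ofReal hi (Filter.Eventually.of_forall fun x => by positivity)).symm
    _ ≤ _ := ENNReal.ofReal_le_ofReal hA

lemma skd_quot (f : ℝ → ℂ) (h1 : Integrable f) (h2 : MemLp f 2) (c : ℝ) (hc : c ≠ 0) :
    eLpNorm (fun x => c⁻¹ • ((𝓕⁻ f) (x + c) - (𝓕⁻ f) x)) 2 volume
      ≤ eLpNorm (fun ξ : ℝ => ((2 * π * ξ : ℝ) : ℂ) * f ξ) 2 volume := by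
  set u : ℝ → ℂ := fun ξ => (c : ℂ)⁻¹ * (Complex.exp (Complex.I * ((2 * π * (ξ * c) : ℝ) : ℂ)) - 1)
  have hu : Continuous u := by fun_prop
  have hub : ∀ ξ, ‖u ξ‖ ≤ |2 * π * ξ| := fun ξ => by
    have := Real.norm_exp_I_mul_ofReal_sub_one_le (x := 2 * π * (ξ * c))
    simp only [u]
    rw [norm_mul, norm_inv, Complex.norm_real, Real.norm_eq_abs]
    rw [Real.norm_eq_abs] at this
    have hc' : 0 < |c| := abs_pos.2 hc
    rw [inv_mul_le_iff₀ hc', ← abs_mul]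
    refine this.trans_eq ?_
    congr 1; ring
  have hub2 : ∀ ξ, ‖u ξ‖ ≤ |c|⁻¹ * 2 := fun ξ => by
    simp only [u]
    rw [norm_mul, norm_inv, Complex.norm_real, Real.norm_eq_abs]
    gcongr
    refine (norm_sub_le _ _).trans ?_
    rw [mul_comm Complex.I, Complex.norm_exp_ofReal_mul_I]; norm_num
  have hui : Integrable (fun ξ => u ξ * f ξ) :=
    h1.bdd_mul hu.aestronglyMeasurable (Filter.Eventually.of_forall hub2)
  have hu2 : MemLp (fun ξ => u ξ * f ξ) 2 := by
    refine h2.of_le_mul (c := |c|⁻¹ * 2) hui.1 (Filter.Eventually.of_forall fun ξ => ?_)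
    rw [norm_mul]; gcongr; exact hub2 ξ
  have heq : (fun x => c⁻¹ • ((𝓕⁻ f) (x + c) - (𝓕⁻ f) x)) = 𝓕⁻ (fun ξ => u ξ * f ξ) := by
    ext x
    have hint : ∀ y : ℝ, Integrable (fun v : ℝ => Complex.exp (((2 * π * (v * y) : ℝ) : ℂ) * Complex.I) • f v) := fun y => by
      refine h1.bdd_mul (c := 1) (Continuous.aestronglyMeasurable (by fun_prop))
        (Filter.Eventually.of_forall fun v => ?_)
      rw [Complex.norm_exp_ofReal_mul_I]
    rw [Real.fourierInv_eq', Real.fourierInv_eq', Real.fourierInv_eq']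
    simp only [RCLike.inner_apply', conj_trivial]
    rw [← integral_sub (hint _) (hint _), ← integral_smul]
    congr 1; ext v
    simp only [u, smul_eq_mul, Complex.real_smul]
    rw [mul_add, mul_add, Complex.ofReal_add, add_mul, Complex.exp_add,
      mul_comm Complex.I]
    push_cast
    ring
  rw [heq, skd_plancherel _ hui hu2]
  apply eLpNorm_mono
  intro ξ
  rw [norm_mul (u ξ), norm_mul _ (f ξ), Complex.norm_real, Real.norm_eq_abs]
  gcongr
  exact hub ξ

lemma skd_deriv (f : ℝ → ℂ) (h1 : Integrable f) (h2 : MemLp f 2) :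
    eLpNorm (deriv (𝓕⁻ f)) 2 volume
      ≤ eLpNorm (fun ξ : ℝ => ((2 * π * ξ : ℝ) : ℂ) * f ξ) 2 volume := by
  have hcont : Continuous (𝓕⁻ f) := by
    have := VectorFourier.fourierIntegral_continuous (L := -innerₗ ℝ) (e := 𝐞) (μ := (volume : Measure ℝ))
      continuous_fourierChar (by simp only [LinearMap.neg_apply, innerₗ_apply_apply]; fun_prop) h1
    exact this
  set g := 𝓕⁻ f with hg
  set D : Set ℝ := {x | DifferentiableAt ℝ g x}
  have hD : MeasurableSet D := measurableSet_of_differentiableAt ℝ g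
  let c : ℕ → ℝ := fun n => 1 / ((n : ℝ) + 1)
  have hc : ∀ n, c n ≠ 0 := fun n => by simp only [c]; positivity
  have hc0 : Filter.Tendsto c Filter.atTop (nhdsWithin 0 {0}ᶜ) :=
    tendsto_nhdsWithin_iff.2 ⟨tendsto_one_div_add_atTop_nhds_zero_nat,
      Filter.Eventually.of_forall hc⟩
  let w : ℕ → ℝ → ℂ := fun n x => (c n)⁻¹ • (g (x + c n) - g x)
  have hw : ∀ n, Continuous (w n) := fun n => by simp only [w]; fun_prop
  have hlim : ∀ x, Filter.Tendsto (fun n => D.indicator (w n) x) Filter.atTop (nhds (deriv g x)) := by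
    intro x
    by_cases hx : x ∈ D
    · simp only [Set.indicator_of_mem hx]
      exact (hasDerivAt_iff_tendsto_slope_zero.1 (DifferentiableAt.hasDerivAt hx)).comp hc0
    · simp only [Set.indicator_of_notMem hx]
      rw [deriv_zero_of_not_differentiableAt hx]
      exact tendsto_const_nhds
  refine (Lp.eLpNorm_lim_le_liminf_eLpNorm
    (fun n => (hw n).aestronglyMeasurable.indicator hD) _
    (Filter.Eventually.of_forall hlim)).trans ?_
  refine Filter.liminf_le_of_le (by isBoundedDefault) ?_
  intro b hb
  obtain ⟨n, hn⟩ := hb.exists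
  exact hn.trans ((eLpNorm_indicator_le _).trans (skd_quot f h1 h2 (c n) (hc n)))

noncomputable def skdf (m t : ℝ) : ℝ → ℂ :=
  fun ξ : ℝ => Complex.exp (-(t : ℂ) * phaseFn m ξ) / (1 + ((|ξ| ^ m : ℝ) : ℂ))

lemma skdf_norm (m t ξ : ℝ) : ‖skdf m t ξ‖ = skdF m 0 1 t ξ := by
  have hy : 0 ≤ |ξ| ^ m := by positivity
  unfold skdf skdF phaseFn
  set y := |ξ| ^ m
  have h1 : (1 + (y : ℂ)) = ((1 + y : ℝ) : ℂ) := by push_cast; rfl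
  have h2 : -(t : ℂ) * (((y : ℂ) - Complex.I * ξ * y) / (1 + (y : ℂ)))
      = ((-t * (y / (1 + y)) : ℝ) : ℂ) + ((t * ξ * y / (1 + y) : ℝ) : ℂ) * Complex.I := by
    push_cast; ring
  rw [h2, h1, norm_div, Complex.exp_add, norm_mul, Complex.norm_exp_ofReal_mul_I, ← Complex.ofReal_exp,
    Complex.norm_real, Complex.norm_real, Real.norm_of_nonneg (by positivity), Real.norm_of_nonneg (by positivity)]
  simp

lemma skdf_norm_sq (m t ξ : ℝ) : ‖skdf m t ξ‖ ^ 2 = skdF m 0 2 (2 * t) ξ := by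
  rw [skdf_norm]; unfold skdF
  rw [div_pow, mul_pow, ← Real.exp_nat_mul, pow_one]
  simp only [Real.rpow_zero, one_pow]
  congr 3; push_cast; ring

lemma skdf_norm_sq' (m t ξ : ℝ) :
    ‖((2 * π * ξ : ℝ) : ℂ) * skdf m t ξ‖ ^ 2 = (2 * π) ^ 2 * skdF m 2 2 (2 * t) ξ := by
  rw [norm_mul, mul_pow, skdf_norm_sq, Complex.norm_real, Real.norm_eq_abs, abs_mul,
    abs_of_pos (by positivity : 0 < 2 * π)]
  unfold skdF
  rw [show |ξ| ^ (2 : ℝ) = |ξ| ^ 2 by norm_cast, Real.rpow_zero]; ring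

lemma skdf_meas (m t : ℝ) : Measurable (skdf m t) := by
  unfold skdf phaseFn; fun_prop

theorem semigroupKernel_decay (m : ℝ) (hm : 3 / 2 < m) :
    ∃ C > 0, ∀ t : ℝ, 0 ≤ t →
      eLpNorm (semigroupKernel m t) 2 volume ≤
          ENNReal.ofReal (C * (1 + t) ^ (-(1 / (2 * m)))) ∧
      eLpNorm (deriv (semigroupKernel m t)) 2 volume ≤
          ENNReal.ofReal (C * (1 + t) ^ (-(1 / (2 * m)) - 1 / m)) ∧
      eLpNorm (semigroupKernel m t) ⊤ volume ≤
          ENNReal.ofReal (C * (1 + t) ^ (-(1 / m))) := by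
  have hm0 : 0 < m := by linarith
  obtain ⟨C1, hC1, H1⟩ := skd_est m 0 2 hm0 le_rfl (by push_cast; linarith)
  obtain ⟨C2, hC2, H2⟩ := skd_est m 2 2 hm0 (by norm_num) (by push_cast; linarith)
  obtain ⟨C3, hC3, H3⟩ := skd_est m 0 1 hm0 le_rfl (by push_cast; linarith)
  set K1 := C1 ^ (1 / 2 : ℝ)
  set K2 := ((2 * π) ^ 2 * C2) ^ (1 / 2 : ℝ)
  have hK1 : 0 < K1 := by positivity
  have hK2 : 0 < K2 := by positivity
  refine ⟨K1 + K2 + C3, by positivity, fun t ht => ?_⟩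
  have hT0 : 0 < 1 + t := by linarith
  have mono : ∀ p : ℝ, 0 ≤ p → (1 + 2 * t) ^ (-p) ≤ (1 + t) ^ (-p) := fun p hp =>
    Real.rpow_le_rpow_of_nonpos hT0 (by linarith) (by linarith)
  have hker : semigroupKernel m t = 𝓕⁻ (skdf m t) := rfl
  obtain ⟨i1, b1⟩ := H1 (2 * t) (by positivity)
  obtain ⟨i2, b2⟩ := H2 (2 * t) (by positivity)
  obtain ⟨i3, b3⟩ := H3 t ht
  have hint : Integrable (skdf m t) := by
    refine (integrable_norm_iff (skdf_meas m t).aestronglyMeasurable).1 ?_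
    simpa only [skdf_norm] using i3
  have hmem : MemLp (skdf m t) 2 := by
    refine (memLp_two_iff_integrable_sq_norm (skdf_meas m t).aestronglyMeasurable).2 ?_
    simpa only [skdf_norm_sq] using i1
  rw [hker]
  refine ⟨?_, ?_, ?_⟩
  · rw [skd_plancherel _ hint hmem]
    refine (skd_L2 _ (C1 * (1 + t) ^ (-(1 / m))) ?_ ?_).trans (ENNReal.ofReal_le_ofReal ?_)
    · simpa only [skdf_norm_sq] using i1
    · simp only [skdf_norm_sq]
      refine b1.trans ?_
      rw [zero_add]; exact mul_le_mul_of_nonneg_left (mono _ (by positivity)) hC1.le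
    · rw [Real.mul_rpow hC1.le (by positivity), ← Real.rpow_mul hT0.le,
        show -(1 / m) * (1 / 2) = -(1 / (2 * m)) by field_simp]
      gcongr; linarith
  · refine (skd_deriv _ hint hmem).trans ?_
    refine (skd_L2 _ (((2 * π) ^ 2 * C2) * (1 + t) ^ (-(3 / m))) ?_ ?_).trans (ENNReal.ofReal_le_ofReal ?_)
    · simpa only [skdf_norm_sq'] using i2.const_mul _
    · simp only [skdf_norm_sq']
      rw [integral_const_mul, mul_assoc]
      gcongr
      refine b2.trans ?_
      rw [show (2 : ℝ) + 1 = 3 by norm_num]; exact mul_le_mul_of_nonneg_left (mono _ (by positivity)) hC2.le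
    · rw [Real.mul_rpow (by positivity) (by positivity), ← Real.rpow_mul hT0.le,
        show -(3 / m) * (1 / 2) = -(1 / (2 * m)) - 1 / m by field_simp; norm_num]
      gcongr; linarith
  · rw [eLpNorm_exponent_top]
    refine eLpNormEssSup_le_of_ae_bound (Filter.Eventually.of_forall fun x => ?_)
    have : ‖(𝓕⁻ (skdf m t)) x‖ ≤ ∫ v, ‖skdf m t v‖ :=
      VectorFourier.norm_fourierIntegral_le_integral_norm _ _ _ _ _
    refine this.trans ?_
    simp only [skdf_norm]
    refine b3.trans ?_
    rw [zero_add]; gcongr; linarith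
end

section
/- Let m ≥ 1, N ∈ ℕ. Define S_φ(·,t) by its Fourier transform e^{−t|ξ|^m/(1+|ξ|^m)} φ(ξ) where φ ∈ C_0^∞(ℝ) is a cut-off with 0 ≤ φ ≤ 1, φ = 1 on |ξ| ≤ 1, φ = 0 on |ξ| > 2. Let K_m^j be the j-fold convolution of K_m (K̂_m(ξ) = 1/(1+|ξ|^m)), G_m the kernel with Ĝ_m(ξ,t) = e^{−t|ξ|^m}, and M the multiplier |ξ|^m. Then there is C = C(N,m) such that for all t > 0 and u₀ ∈ L¹(ℝ): ‖S_φ(t) ∗ u₀ − ∑_{j=0}^N (t^j/j!) K_m^j ∗ M^{2j} G_m(t) ∗ u₀‖_{L²} ≤ C t^{−(N+1) − 1/(2m)} ‖u₀‖_{L¹} + C e^{−t/2} t^{−1/(2m)} (∑_{j=0}^N t^{−j}/j!) ‖u₀‖_{L¹}. -/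
open MeasureTheory Real FourierTransform Complex Finset

/-- The low-frequency part `S_φ(t)`, with Fourier transform
`e^{−t|ξ|^m/(1+|ξ|^m)} φ(ξ)`. -/
noncomputable def lowFreqKernel (m : ℝ) (φ : ℝ → ℝ) (t : ℝ) : ℝ → ℂ :=
  𝓕⁻ (fun ξ : ℝ => ((Real.exp (-t * |ξ| ^ m / (1 + |ξ| ^ m)) * φ ξ : ℝ) : ℂ))

/-- The kernel `K_m^j ∗ M^{2j} G_m(t)`, with Fourier transform
`(1/(1+|ξ|^m))^j |ξ|^{2mj} e^{−t|ξ|^m}`. -/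
noncomputable def expansionKernel (m : ℝ) (j : ℕ) (t : ℝ) : ℝ → ℂ :=
  𝓕⁻ (fun ξ : ℝ =>
    (((1 / (1 + |ξ| ^ m)) ^ j * |ξ| ^ (2 * m * (j : ℝ)) * Real.exp (-t * |ξ| ^ m) : ℝ) : ℂ))


lemma integrable_fourierChar_mul (g : ℝ → ℂ) (hg : Integrable g) (x : ℝ) :
    Integrable (fun ξ : ℝ => (𝐞 (ξ * x) : ℂ) * g ξ) := by
  have := (Real.fourierIntegral_convergent_iff (μ := volume) (f := g) (-x)).2 hg
  refine this.congr (Filter.Eventually.of_forall fun ξ => ?_)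
  simp [Circle.smul_def, mul_comm]

lemma convOn_fourierInv (g u : ℝ → ℂ) (hg : Integrable g) (hu : Integrable u) (x : ℝ) :
    convOn (𝓕⁻ g) u x = 𝓕⁻ (fun ξ => g ξ * 𝓕 u ξ) x := by
  have hG := integrable_fourierChar_mul g hg x
  have key := VectorFourier.integral_fourierIntegral_smul_eq_flip (μ := (volume : Measure ℝ))
    (ν := (volume : Measure ℝ)) (L := innerₗ ℝ) (e := 𝐞) (f := fun ξ : ℝ => (𝐞 (ξ * x) : ℂ) * g ξ)
    (g := u) Real.continuous_fourierChar (by fun_prop) hG hu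
  rw [flip_innerₗ] at key
  have h1 : ∀ y, 𝓕⁻ g (x - y) = VectorFourier.fourierIntegral 𝐞 volume (innerₗ ℝ)
      (fun ξ : ℝ => (𝐞 (ξ * x) : ℂ) * g ξ) y := by
    intro y
    rw [Real.fourierInv_eq, VectorFourier.fourierIntegral]
    congr 1
    ext ξ
    simp only [Circle.smul_def, smul_eq_mul, ← mul_assoc, ← Circle.coe_mul, ← AddChar.map_add_eq_mul]
    congr 4
    simp
    ring
  unfold convOn
  simp_rw [h1]
  simp only [smul_eq_mul] at key
  rw [key, Real.fourierInv_eq]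
  congr 1
  ext ξ
  simp only [Circle.smul_def, smul_eq_mul, mul_assoc]
  congr 3
  simp [mul_comm]

lemma eLpNorm_fourier_eq (f : ℝ → ℂ) (h1 : Integrable f) (h2 : MemLp f 2 volume) :
    eLpNorm (𝓕 f) 2 volume = eLpNorm f 2 volume := by
  have hae : 𝓕 f =ᵐ[volume] (𝓕 (h2.toLp f) : Lp (α := ℝ) ℂ 2 volume) := by
    apply ae_eq_of_integral_contDiff_smul_eq
    · have : Continuous (𝓕 f) := VectorFourier.fourierIntegral_continuous Real.continuous_fourierChar
        (innerSL ℝ).continuous₂ h1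
      exact this.locallyIntegrable
    · exact (Lp.memLp _).locallyIntegrable (by norm_num)
    · intro g gs gc
      have hg₁ : HasCompactSupport (Complex.ofRealCLM ∘ g) := gc.comp_left rfl
      have hg₂ : ContDiff ℝ (⊤ : ℕ∞) (Complex.ofRealCLM ∘ g) := by fun_prop
      set G := hg₁.toSchwartzMap hg₂ with hG
      have hGx : ∀ x, G x = (g x : ℂ) := fun x => by simp [hG]
      have e1 : ∫ x, g x • (𝓕 (h2.toLp f) : Lp (α := ℝ) ℂ 2 volume) x =
          ((𝓕 (h2.toLp f) : Lp (α := ℝ) ℂ 2 volume) : TemperedDistribution ℝ ℂ) G := by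
        rw [Lp.toTemperedDistribution_apply]
        simp [hGx]
      rw [e1, ← Lp.fourier_toTemperedDistribution_eq, TemperedDistribution.fourier_apply,
        Lp.toTemperedDistribution_apply]
      have key := VectorFourier.integral_fourierIntegral_smul_eq_flip (μ := (volume : Measure ℝ))
        (ν := (volume : Measure ℝ)) (L := innerₗ ℝ) (e := 𝐞) (f := G)
        (g := f) Real.continuous_fourierChar (by fun_prop) G.integrable h1
      rw [flip_innerₗ] at key
      have e2 : ∫ x, g x • 𝓕 f x = ∫ x, G x • VectorFourier.fourierIntegral 𝐞 volume (innerₗ ℝ) f x := by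
        simp_rw [hGx]; rfl
      rw [e2, ← key]
      apply integral_congr_ae
      filter_upwards [h2.coeFn_toLp] with x hx
      rw [hx]; rfl
  rw [eLpNorm_congr_ae hae]
  have := Lp.norm_fourier_eq (h2.toLp f)
  rw [Lp.norm_def, Lp.norm_def, ENNReal.toReal_eq_toReal_iff' (Lp.eLpNorm_ne_top _) (Lp.eLpNorm_ne_top _)] at this
  rw [this, eLpNorm_congr_ae h2.coeFn_toLp]

lemma eLpNorm_fourierInv_eq (f : ℝ → ℂ) (h1 : Integrable f) (h2 : MemLp f 2 volume) :
    eLpNorm (𝓕⁻ f) 2 volume = eLpNorm f 2 volume := by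
  rw [← eLpNorm_fourier_eq f h1 h2]
  have : 𝓕⁻ f = 𝓕 f ∘ Neg.neg := by ext x; exact Real.fourierInv_eq_fourier_neg f x
  have hc : Continuous (𝓕 f) := VectorFourier.fourierIntegral_continuous Real.continuous_fourierChar
        (innerSL ℝ).continuous₂ h1
  rw [this, eLpNorm_comp_measurePreserving hc.aestronglyMeasurable
    (Measure.measurePreserving_neg volume)]

lemma cont_abs_rpow (m : ℝ) (hm : 0 ≤ m) : Continuous (fun ξ : ℝ => |ξ| ^ m) :=
  continuous_abs.rpow_const fun _ => Or.inr hm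

lemma integral_exp_abs (m b : ℝ) (hm : 1 ≤ m) (hb : 0 < b) :
    ∫ ξ : ℝ, Real.exp (-b * |ξ| ^ m) = 2 * (b ^ (-1 / m) * Real.Gamma (1 / m + 1)) := by
  rw [integral_comp_abs (f := fun x => Real.exp (-b * x ^ m)),
    _root_.integral_exp_neg_mul_rpow (by linarith) hb]

lemma integrable_exp_abs (m b : ℝ) (hm : 1 ≤ m) (hb : 0 < b) :
    Integrable (fun ξ : ℝ => Real.exp (-b * |ξ| ^ m)) := by
  refine Integrable.of_integral_ne_zero ?_
  rw [integral_exp_abs m b hm hb]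
  have hm0 : 0 < m := by linarith
  have hG : 0 < Real.Gamma (1 / m + 1) := Real.Gamma_pos_of_pos (by positivity)
  positivity

lemma memLp_exp_abs (m b : ℝ) (hm : 1 ≤ m) (hb : 0 < b) :
    MemLp (fun ξ : ℝ => Real.exp (-b * |ξ| ^ m)) 2 volume := by
  have hc : Continuous (fun ξ : ℝ => Real.exp (-b * |ξ| ^ m)) :=
    Real.continuous_exp.comp (continuous_const.mul (cont_abs_rpow m (by linarith)))
  rw [memLp_two_iff_integrable_sq hc.aestronglyMeasurable]
  refine (integrable_exp_abs m (2 * b) hm (by positivity)).congr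
    (Filter.Eventually.of_forall fun ξ => ?_)
  simp only [← Real.exp_nat_mul]
  congr 1
  push_cast
  ring

lemma eLpNorm_exp_abs (m c : ℝ) (hm : 1 ≤ m) (hc : 0 < c) : ∃ A > 0, ∀ t : ℝ, 0 < t →
    eLpNorm (fun ξ : ℝ => Real.exp (-(c * t) * |ξ| ^ m)) 2 volume
      = ENNReal.ofReal (A * t ^ (-(1 / (2 * m)))) := by
  have hm0 : 0 < m := by linarith
  have hG : 0 < Real.Gamma (1 / m + 1) := Real.Gamma_pos_of_pos (by positivity)
  refine ⟨(2 * ((2 * c) ^ (-1 / m) * Real.Gamma (1 / m + 1))) ^ (2⁻¹ : ℝ), by positivity, ?_⟩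
  intro t ht
  rw [(memLp_exp_abs m (c * t) hm (by positivity)).eLpNorm_eq_integral_rpow_norm (by norm_num)
    (by norm_num)]
  have h : ∀ ξ : ℝ, ‖Real.exp (-(c * t) * |ξ| ^ m)‖ ^ (2 : ENNReal).toReal
      = Real.exp (-((2 * c) * t) * |ξ| ^ m) := by
    intro ξ
    rw [Real.norm_eq_abs, abs_of_pos (Real.exp_pos _), ← Real.exp_mul]
    congr 1
    simp
    ring
  simp_rw [h]
  rw [integral_exp_abs m _ hm (by positivity), Real.mul_rpow (by positivity) ht.le]
  congr 1
  rw [show 2 * ((2 * c) ^ (-1 / m) * t ^ (-1 / m) * Real.Gamma (1 / m + 1))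
    = (2 * ((2 * c) ^ (-1 / m) * Real.Gamma (1 / m + 1))) * t ^ (-1 / m) by ring]
  rw [ENNReal.toReal_ofNat, Real.mul_rpow (by positivity) (by positivity), ← Real.rpow_mul ht.le]
  congr 2
  field_simp

lemma pow_le_exp_quarter (x : ℝ) (hx : 0 ≤ x) (k : ℕ) :
    x ^ k ≤ 4 ^ k * k.factorial * Real.exp (x / 4) := by
  have h := Real.pow_div_factorial_le_exp (x / 4) (by positivity) k
  rw [div_le_iff₀ (by positivity), div_pow, div_le_iff₀ (by positivity)] at h
  linarith

/-- the full symbol, as a function of `a = |ξ|^m` -/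
lemma symb_low (N : ℕ) (t a : ℝ) (ht : 0 < t) (ha : 0 ≤ a) (ha1 : a ≤ 1) :
    |Real.exp (-t * a / (1 + a)) - ∑ j ∈ range (N + 1), t ^ j / Nat.factorial j *
      ((1 / (1 + a)) ^ j * a ^ (2 * j) * Real.exp (-t * a))| ≤
    4 ^ (2 * (N + 1)) * (2 * (N + 1)).factorial * (t ^ (N + 1))⁻¹ * Real.exp (-(t * a) / 4) := by
  set s := t * a ^ 2 / (1 + a) with hs
  have hs0 : 0 ≤ s := by positivity
  have e1 : Real.exp (-t * a / (1 + a)) = Real.exp (-t * a) * Real.exp s := by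
    rw [← Real.exp_add]; congr 1; rw [hs]; field_simp; ring
  have e2 : ∑ j ∈ range (N + 1), t ^ j / Nat.factorial j *
      ((1 / (1 + a)) ^ j * a ^ (2 * j) * Real.exp (-t * a))
      = Real.exp (-t * a) * ∑ j ∈ range (N + 1), s ^ j / Nat.factorial j := by
    rw [mul_sum]
    refine sum_congr rfl fun j _ => ?_
    rw [hs]
    simp only [div_pow, mul_pow, one_pow, ← pow_mul]
    ring
  have h := Complex.norm_exp_sub_sum_le_norm_mul_exp (s : ℂ) (N + 1)
  have e3 : ‖cexp (s : ℂ) - ∑ j ∈ range (N + 1), (s : ℂ) ^ j / (Nat.factorial j : ℂ)‖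
      = |Real.exp s - ∑ j ∈ range (N + 1), s ^ j / Nat.factorial j| := by
    rw [← Real.norm_eq_abs, ← Complex.norm_real]
    push_cast
    rfl
  rw [e3, Complex.norm_real, Real.norm_eq_abs, abs_of_nonneg hs0] at h
  have h5 : s ≤ t * a ^ 2 := div_le_self (by positivity) (by linarith)
  have h6 : -t * a / (1 + a) ≤ -(t * a) / 2 := by
    rw [div_le_div_iff₀ (by positivity) (by positivity)]
    nlinarith [mul_nonneg (mul_nonneg ht.le ha) (sub_nonneg.2 ha1)]
  have h7 := pow_le_exp_quarter (t * a) (by positivity) (2 * (N + 1))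
  rw [e2, e1, ← mul_sub, abs_mul, abs_of_pos (Real.exp_pos _)]
  calc Real.exp (-t * a) * |Real.exp s - ∑ j ∈ range (N + 1), s ^ j / Nat.factorial j|
      ≤ Real.exp (-t * a) * (s ^ (N + 1) * Real.exp s) := by gcongr
    _ = s ^ (N + 1) * Real.exp (-t * a / (1 + a)) := by rw [e1]; ring
    _ ≤ (t * a ^ 2) ^ (N + 1) * Real.exp (-(t * a) / 2) := by gcongr
    _ = (t * a) ^ (2 * (N + 1)) * (t ^ (N + 1))⁻¹ * Real.exp (-(t * a) / 2) := by
      congr 1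
      field_simp
      rw [pow_mul, ← mul_pow]
      congr 1
      ring
    _ ≤ (4 ^ (2 * (N + 1)) * (2 * (N + 1)).factorial * Real.exp (t * a / 4))
          * (t ^ (N + 1))⁻¹ * Real.exp (-(t * a) / 2) := by gcongr
    _ = 4 ^ (2 * (N + 1)) * (2 * (N + 1)).factorial * (t ^ (N + 1))⁻¹ *
        (Real.exp (t * a / 4) * Real.exp (-(t * a) / 2)) := by ring
    _ = _ := by rw [← Real.exp_add]; congr 2; ring

lemma symb_term (j : ℕ) (t a : ℝ) (ht : 0 < t) (ha : 0 ≤ a) :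
    t ^ j / Nat.factorial j * ((1 / (1 + a)) ^ j * a ^ (2 * j) * Real.exp (-t * a)) ≤
      4 ^ j * Real.exp (-(3 * (t * a)) / 4) := by
  have h7 := pow_le_exp_quarter (t * a) (by positivity) j
  have h8 : (1 / (1 + a)) ^ j * a ^ (2 * j) ≤ a ^ j := by
    rw [pow_mul, ← mul_pow]
    gcongr
    rw [one_div, inv_mul_le_iff₀ (by positivity)]
    nlinarith
  calc t ^ j / Nat.factorial j * ((1 / (1 + a)) ^ j * a ^ (2 * j) * Real.exp (-t * a))
      ≤ t ^ j / Nat.factorial j * (a ^ j * Real.exp (-t * a)) := by gcongr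
    _ = (t * a) ^ j / Nat.factorial j * Real.exp (-t * a) := by rw [mul_pow]; ring
    _ ≤ (4 ^ j * j.factorial * Real.exp (t * a / 4)) / Nat.factorial j * Real.exp (-t * a) := by
      gcongr
    _ = 4 ^ j * (Real.exp (t * a / 4) * Real.exp (-t * a)) := by
      have : (Nat.factorial j : ℝ) ≠ 0 := by positivity
      field_simp
    _ = _ := by rw [← Real.exp_add]; congr 2; ring

lemma symb_high (N : ℕ) (t a B p : ℝ) (ht : 0 < t) (ha1 : 1 < a) (hB : 1 ≤ B)
    (hp : 0 ≤ p ∧ p ≤ 1) (hpB : B < a → p = 0) :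
    |Real.exp (-t * a / (1 + a)) * p - ∑ j ∈ range (N + 1), t ^ j / Nat.factorial j *
      ((1 / (1 + a)) ^ j * a ^ (2 * j) * Real.exp (-t * a))| ≤
    (4 ^ (N + 1) * (N + 1).factorial * (t ^ (N + 1))⁻¹ +
      (∑ j ∈ range (N + 1), (4 : ℝ) ^ j) * Real.exp (-t / 2)) *
        Real.exp (-(1 / (4 * B) * t) * a) := by
  have ha : 0 < a := by linarith
  have hB0 : 0 < B := by linarith
  have hta : t ≤ t * a := by nlinarith
  have hBa : 1 / (4 * B) * t * a ≤ t * a / 4 := by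
    rw [div_mul_eq_mul_div, one_mul, div_mul_eq_mul_div,
      div_le_div_iff₀ (by positivity) (by positivity)]
    nlinarith [mul_le_mul_of_nonneg_left hB (by positivity : 0 ≤ t * a)]
  have hfirst : Real.exp (-t * a / (1 + a)) * p ≤
      4 ^ (N + 1) * (N + 1).factorial * (t ^ (N + 1))⁻¹ * Real.exp (-(1 / (4 * B) * t) * a) := by
    by_cases h : B < a
    · rw [hpB h, mul_zero]; positivity
    push Not at h
    have h6 : -t * a / (1 + a) ≤ -(t / 4) + -(t / 4) := by
      rw [div_le_iff₀ (by positivity)]; nlinarith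
    have h7 := pow_le_exp_quarter t ht.le (N + 1)
    have h8 : Real.exp (-(t / 4)) ≤ 4 ^ (N + 1) * (N + 1).factorial * (t ^ (N + 1))⁻¹ := by
      rw [Real.exp_neg, ← div_eq_mul_inv, inv_eq_one_div, div_le_div_iff₀ (by positivity) (by positivity)]
      linarith
    have h9 : -(t / 4) ≤ -(1 / (4 * B) * t) * a := by
      rw [neg_mul, neg_le_neg_iff, div_mul_eq_mul_div, one_mul, div_mul_eq_mul_div,
        div_le_div_iff₀ (by positivity) (by positivity)]
      nlinarith [mul_le_mul_of_nonneg_left h ht.le]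
    calc Real.exp (-t * a / (1 + a)) * p ≤ Real.exp (-t * a / (1 + a)) * 1 := by
          gcongr; exact hp.2
      _ ≤ Real.exp (-(t / 4) + -(t / 4)) := by rw [mul_one]; gcongr
      _ = Real.exp (-(t / 4)) * Real.exp (-(t / 4)) := Real.exp_add _ _
      _ ≤ _ := by gcongr
  have hsecond : ∑ j ∈ range (N + 1), t ^ j / Nat.factorial j *
      ((1 / (1 + a)) ^ j * a ^ (2 * j) * Real.exp (-t * a)) ≤
      (∑ j ∈ range (N + 1), (4 : ℝ) ^ j) * Real.exp (-t / 2) *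
        Real.exp (-(1 / (4 * B) * t) * a) := by
    rw [mul_assoc, sum_mul, ← Real.exp_add]
    refine sum_le_sum fun j _ => (symb_term j t a ht ha.le).trans ?_
    gcongr
    linarith
  have n1 : 0 ≤ Real.exp (-t * a / (1 + a)) * p := mul_nonneg (Real.exp_pos _).le hp.1
  have n2 : 0 ≤ ∑ j ∈ range (N + 1), t ^ j / Nat.factorial j *
      ((1 / (1 + a)) ^ j * a ^ (2 * j) * Real.exp (-t * a)) :=
    sum_nonneg fun j _ => by positivity
  rw [add_mul]
  refine abs_le.2 ⟨?_, ?_⟩ <;> linarith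

lemma abs_rpow_two_mul (m : ℝ) (hm : 1 ≤ m) (j : ℕ) (ξ : ℝ) :
    |ξ| ^ (2 * m * (j : ℝ)) = (|ξ| ^ m) ^ (2 * j) := by
  rw [← Real.rpow_natCast, ← Real.rpow_mul (abs_nonneg ξ)]
  congr 1
  push_cast
  ring

lemma symb_bound (m : ℝ) (hm : 1 ≤ m) (N : ℕ) (φ : ℝ → ℝ)
    (hφ01 : ∀ ξ, 0 ≤ φ ξ ∧ φ ξ ≤ 1)
    (hφ1 : ∀ ξ, |ξ| ≤ 1 → φ ξ = 1)
    (hφ0 : ∀ ξ, 2 < |ξ| → φ ξ = 0) : ∃ C > 0, ∀ t : ℝ, 0 < t → ∀ ξ : ℝ,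
    |Real.exp (-t * |ξ| ^ m / (1 + |ξ| ^ m)) * φ ξ -
      ∑ j ∈ range (N + 1), t ^ j / Nat.factorial j *
      ((1 / (1 + |ξ| ^ m)) ^ j * |ξ| ^ (2 * m * (j : ℝ)) * Real.exp (-t * |ξ| ^ m))| ≤
    C * ((t ^ (N + 1))⁻¹ + Real.exp (-t / 2)) *
      Real.exp (-(1 / (4 * 2 ^ m) * t) * |ξ| ^ m) := by
  have hm0 : 0 < m := by linarith
  set C1 : ℝ := 4 ^ (2 * (N + 1)) * (2 * (N + 1)).factorial with hC1
  set C2 : ℝ := 4 ^ (N + 1) * (N + 1).factorial with hC2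
  set C3 : ℝ := ∑ j ∈ range (N + 1), (4 : ℝ) ^ j with hC3
  have p1 : 0 < C1 := by positivity
  have p2 : 0 < C2 := by positivity
  have p3 : 0 ≤ C3 := by positivity
  have hB : (1 : ℝ) ≤ 2 ^ m := Real.one_le_rpow (by norm_num) hm0.le
  refine ⟨C1 + C2 + C3, by positivity, fun t ht ξ => ?_⟩
  simp_rw [abs_rpow_two_mul m hm]
  have ha : 0 ≤ |ξ| ^ m := by positivity
  have pt : 0 < (t ^ (N + 1))⁻¹ := by positivity
  have pe : 0 < Real.exp (-t / 2) := Real.exp_pos _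
  by_cases h : |ξ| ≤ 1
  · rw [hφ1 ξ h, mul_one]
    refine (symb_low N t _ ht ha (Real.rpow_le_one (abs_nonneg _) h hm0.le)).trans ?_
    rw [← hC1]
    gcongr ?_ * Real.exp ?_
    · nlinarith [mul_pos p1 pe, mul_pos p2 pt, mul_pos p2 pe, mul_nonneg p3 pt.le,
        mul_nonneg p3 pe.le]
    · rw [neg_mul, neg_div, neg_le_neg_iff, div_mul_eq_mul_div, one_mul, div_mul_eq_mul_div,
        div_le_div_iff₀ (by positivity) (by positivity)]
      nlinarith [mul_le_mul_of_nonneg_left hB (by positivity : 0 ≤ t * |ξ| ^ m)]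
  · push Not at h
    refine (symb_high N t _ (2 ^ m) (φ ξ) ht (Real.one_lt_rpow h hm0) hB (hφ01 ξ) ?_).trans ?_
    · intro h2
      exact hφ0 ξ ((Real.rpow_lt_rpow_iff (by norm_num) (abs_nonneg _) hm0).1 h2)
    · rw [← hC2, ← hC3]
      gcongr ?_ * _
      nlinarith [mul_pos p1 pe, mul_pos p1 pt, mul_pos p2 pe, mul_nonneg p3 pt.le]

lemma integrable_low (m : ℝ) (hm : 1 ≤ m) (φ : ℝ → ℝ) (hφc : Continuous φ)
    (hφsupp : HasCompactSupport φ) (t : ℝ) :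
    Integrable (fun ξ : ℝ => ((Real.exp (-t * |ξ| ^ m / (1 + |ξ| ^ m)) * φ ξ : ℝ) : ℂ)) := by
  have hc := cont_abs_rpow m (by linarith)
  refine Integrable.ofReal (Continuous.integrable_of_hasCompactSupport ?_ hφsupp.mul_left)
  refine Continuous.mul (Real.continuous_exp.comp ?_) hφc
  exact (continuous_const.mul hc).div (continuous_const.add hc) fun ξ => by positivity

lemma integrable_exp (m : ℝ) (hm : 1 ≤ m) (j : ℕ) (t : ℝ) (ht : 0 < t) :
    Integrable (fun ξ : ℝ => (((1 / (1 + |ξ| ^ m)) ^ j * |ξ| ^ (2 * m * (j : ℝ)) *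
      Real.exp (-t * |ξ| ^ m) : ℝ) : ℂ)) := by
  have hc := cont_abs_rpow m (by linarith)
  refine Integrable.ofReal ?_
  simp_rw [abs_rpow_two_mul m hm]
  refine Integrable.mono' ((integrable_exp_abs m (3 * t / 4) hm (by positivity)).const_mul
    (4 ^ j * Nat.factorial j / t ^ j)) ?_ (Filter.Eventually.of_forall fun ξ => ?_)
  · refine Continuous.aestronglyMeasurable ?_
    refine Continuous.mul (Continuous.mul (Continuous.pow ?_ _) (hc.pow _)) (Real.continuous_exp.comp
      (continuous_const.mul hc))
    exact continuous_const.div (continuous_const.add hc) fun ξ => by positivity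
  · have h := symb_term j t (|ξ| ^ m) ht (by positivity)
    change ‖(1 / (1 + |ξ| ^ m)) ^ j * (|ξ| ^ m) ^ (2 * j) * Real.exp (-t * |ξ| ^ m)‖ ≤ _
    rw [Real.norm_eq_abs, abs_of_nonneg (by positivity)]
    rw [show -(3 * (t * |ξ| ^ m)) / 4 = -(3 * t / 4) * |ξ| ^ m by ring] at h
    rw [div_mul_eq_mul_div, le_div_iff₀ (by positivity)]
    rw [div_mul_eq_mul_div, div_le_iff₀ (by positivity)] at h
    linarith

theorem lowFreq_expansion (m : ℝ) (hm : 1 ≤ m) (N : ℕ) (φ : ℝ → ℝ)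
    (hφsmooth : ContDiff ℝ (⊤ : ℕ∞) φ) (hφsupp : HasCompactSupport φ)
    (hφ01 : ∀ ξ, 0 ≤ φ ξ ∧ φ ξ ≤ 1)
    (hφ1 : ∀ ξ, |ξ| ≤ 1 → φ ξ = 1)
    (hφ0 : ∀ ξ, 2 < |ξ| → φ ξ = 0) :
    ∃ C > 0, ∀ t : ℝ, 0 < t → ∀ u₀ : ℝ → ℂ, Integrable u₀ →
      eLpNorm (fun x => convOn (lowFreqKernel m φ t) u₀ x -
          ∑ j ∈ Finset.range (N + 1),
            (((t ^ j / Nat.factorial j : ℝ)) : ℂ) * convOn (expansionKernel m j t) u₀ x)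
          2 volume ≤
        ENNReal.ofReal (C * t ^ (-((N : ℝ) + 1) - 1 / (2 * m)) * (∫ x : ℝ, ‖u₀ x‖) +
          C * Real.exp (-t / 2) * t ^ (-(1 / (2 * m))) *
            (∑ j ∈ Finset.range (N + 1), t ^ (-(j : ℝ)) / Nat.factorial j) *
            ∫ x : ℝ, ‖u₀ x‖) := by
  have hm0 : 0 < m := by linarith
  obtain ⟨C, hC, hsymb⟩ := symb_bound m hm N φ hφ01 hφ1 hφ0
  obtain ⟨A, hA, hnorm⟩ := eLpNorm_exp_abs m (1 / (4 * 2 ^ m)) hm (by positivity)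
  refine ⟨C * A, by positivity, fun t ht u₀ hu => ?_⟩
  set g : ℝ → ℂ := fun ξ : ℝ => ((Real.exp (-t * |ξ| ^ m / (1 + |ξ| ^ m)) * φ ξ : ℝ) : ℂ) with hg
  set G : ℕ → ℝ → ℂ := fun j (ξ : ℝ) => (((1 / (1 + |ξ| ^ m)) ^ j * |ξ| ^ (2 * m * (j : ℝ)) *
      Real.exp (-t * |ξ| ^ m) : ℝ) : ℂ) with hG
  set U : ℝ := ∫ x : ℝ, ‖u₀ x‖ with hU
  have hU0 : 0 ≤ U := integral_nonneg fun _ => norm_nonneg _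
  have ig : Integrable g := integrable_low m hm φ hφsmooth.continuous hφsupp t
  have iG : ∀ j, Integrable (G j) := fun j => integrable_exp m hm j t ht
  have hûc : Continuous (𝓕 u₀) := VectorFourier.fourierIntegral_continuous
    Real.continuous_fourierChar (innerSL ℝ).continuous₂ hu
  have hûb : ∀ ξ, ‖𝓕 u₀ ξ‖ ≤ U := fun ξ =>
    VectorFourier.norm_fourierIntegral_le_integral_norm _ _ _ _ _
  have mulI : ∀ f : ℝ → ℂ, Integrable f → Integrable (fun ξ => f ξ * 𝓕 u₀ ξ) := fun f hf =>
    hf.mul_bdd (c := U) hûc.aestronglyMeasurable (Filter.Eventually.of_forall hûb)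
  set h : ℝ → ℂ := fun ξ => g ξ - ∑ j ∈ range (N + 1), ((t ^ j / Nat.factorial j : ℝ) : ℂ) * G j ξ
    with hh
  have ih : Integrable h := ig.sub (integrable_finsetSum _ fun j _ => (iG j).const_mul _)
  have hhb : ∀ ξ, ‖h ξ‖ ≤ C * ((t ^ (N + 1))⁻¹ + Real.exp (-t / 2)) *
      Real.exp (-(1 / (4 * 2 ^ m) * t) * |ξ| ^ m) := by
    intro ξ
    refine le_trans (le_of_eq ?_) (hsymb t ht ξ)
    rw [← Real.norm_eq_abs, ← Complex.norm_real]
    simp only [hh, hg, hG]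
    push_cast
    rfl
  set D : ℝ := C * ((t ^ (N + 1))⁻¹ + Real.exp (-t / 2)) with hD
  have hD0 : 0 ≤ D := by positivity
  have iF := mulI h ih
  have hFb : ∀ ξ, ‖h ξ * 𝓕 u₀ ξ‖ ≤ (D * U) * Real.exp (-(1 / (4 * 2 ^ m) * t) * |ξ| ^ m) := by
    intro ξ
    rw [norm_mul]
    calc ‖h ξ‖ * ‖𝓕 u₀ ξ‖ ≤ (D * Real.exp (-(1 / (4 * 2 ^ m) * t) * |ξ| ^ m)) * U := by
          gcongr
          exacts [hhb ξ, hûb ξ]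
      _ = _ := by ring
  have mF : MemLp (fun ξ => h ξ * 𝓕 u₀ ξ) 2 volume :=
    MemLp.mono' ((memLp_exp_abs m (1 / (4 * 2 ^ m) * t) hm (by positivity)).const_mul (D * U))
      iF.aestronglyMeasurable (Filter.Eventually.of_forall hFb)
  have hfun : (fun x => convOn (lowFreqKernel m φ t) u₀ x -
          ∑ j ∈ Finset.range (N + 1),
            (((t ^ j / Nat.factorial j : ℝ)) : ℂ) * convOn (expansionKernel m j t) u₀ x)
      = 𝓕⁻ (fun ξ => h ξ * 𝓕 u₀ ξ) := by
    ext x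
    have c1 : convOn (lowFreqKernel m φ t) u₀ x = 𝓕⁻ (fun ξ => g ξ * 𝓕 u₀ ξ) x :=
      convOn_fourierInv g u₀ ig hu x
    have c2 : ∀ j, convOn (expansionKernel m j t) u₀ x = 𝓕⁻ (fun ξ => G j ξ * 𝓕 u₀ ξ) x :=
      fun j => convOn_fourierInv (G j) u₀ (iG j) hu x
    have ii : ∀ f : ℝ → ℂ, Integrable f →
        Integrable (fun ξ : ℝ => (𝐞 (ξ * x) : ℂ) * (f ξ * 𝓕 u₀ ξ)) := fun f hf =>
      integrable_fourierChar_mul _ (mulI f hf) x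
    have fi : ∀ f : ℝ → ℂ, 𝓕⁻ f x = ∫ ξ, (𝐞 (ξ * x) : ℂ) * f ξ := by
      intro f
      rw [Real.fourierInv_eq]
      simp [Circle.smul_def, mul_comm]
    rw [c1]
    simp_rw [c2, fi, ← integral_const_mul]
    rw [← integral_finsetSum _ fun j _ => (ii _ (iG j)).const_mul _,
      ← integral_sub (ii _ ig) (integrable_finsetSum _ fun j _ => (ii _ (iG j)).const_mul _)]
    congr 1
    ext ξ
    simp only [hh, sub_mul, mul_sub, sum_mul, mul_sum]
    congr 1
    refine sum_congr rfl fun j _ => ?_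
    ring
  rw [hfun, eLpNorm_fourierInv_eq _ iF mF]
  refine (eLpNorm_mono_real hFb).trans ?_
  have e1 : eLpNorm (fun ξ : ℝ => (D * U) * Real.exp (-(1 / (4 * 2 ^ m) * t) * |ξ| ^ m)) 2 volume
      = ENNReal.ofReal (D * U * (A * t ^ (-(1 / (2 * m))))) := by
    have := eLpNorm_const_smul (D * U) (fun ξ : ℝ => Real.exp (-(1 / (4 * 2 ^ m) * t) * |ξ| ^ m))
      2 (volume : Measure ℝ)
    rw [hnorm t ht, Real.enorm_of_nonneg (by positivity), ← ENNReal.ofReal_mul (by positivity)]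
      at this
    exact this
  rw [e1]
  apply ENNReal.ofReal_le_ofReal
  have e2 : t ^ (-((N : ℝ) + 1) - 1 / (2 * m)) = (t ^ (N + 1))⁻¹ * t ^ (-(1 / (2 * m))) := by
    rw [sub_eq_add_neg, Real.rpow_add ht, Real.rpow_neg ht.le, ← Real.rpow_natCast]
    push_cast
    rfl
  have e3 : 1 ≤ ∑ j ∈ Finset.range (N + 1), t ^ (-(j : ℝ)) / Nat.factorial j := by
    rw [sum_range_succ']
    have : 0 ≤ ∑ j ∈ Finset.range N, t ^ (-((j + 1 : ℕ) : ℝ)) / Nat.factorial (j + 1) :=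
      sum_nonneg fun j _ => by positivity
    simpa using this
  rw [e2, hD]
  have := mul_le_mul_of_nonneg_left e3
    (by positivity : 0 ≤ C * A * Real.exp (-t / 2) * t ^ (-(1 / (2 * m))) * U)
  linarith
end
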